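/- Fix p ∈ [2,∞). For every w ∈ ℝ, 𝕀ᵃ_p(w) = inf{ 𝕀^q_{p,ν}(w) + H(ν|μ₂) + (1/2)(1 − m₂(ν)) : ν a probability measure on ℝ with m₂(ν) ≤ 1 }. In particular, 𝕀ᵃ_p(w) ≤ 𝕀^q_{p,μ₂}(w) for all w ∈ ℝ. -/

import Mathlib

open MeasureTheory Filter Topology Set ProbabilityTheory
open scoped ENNReal NNReal

noncomputable section

namespace LDP

/-- The nonnegative part of an extended real, as an extended nonnegative real. -/
def erealToENNReal (x : EReal) : ℝ≥0∞ := if x = ⊤ then ⊤ else ENNReal.ofReal x.toReal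

/-- Extended (possibly infinite) integral of an `EReal`-valued function:
positive part minus negative part. -/
def eIntegral (ν : Measure ℝ) (f : ℝ → EReal) : EReal :=
  ((∫⁻ u, erealToENNReal (f u) ∂ν : ℝ≥0∞) : EReal)
    - ((∫⁻ u, erealToENNReal (-f u) ∂ν : ℝ≥0∞) : EReal)

/-- `q`-th absolute moment of a measure on `ℝ`. -/
def mom (q : ℝ) (ν : Measure ℝ) : ℝ≥0∞ := ∫⁻ x, ENNReal.ofReal (|x| ^ q) ∂ν

open Classical in
/-- Relative entropy `H(ν|μ)`. -/
def relEnt (ν μ : Measure ℝ) : EReal :=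
  if ν ≪ μ then eIntegral ν (fun x => ENNReal.log (ν.rnDeriv μ x)) else ⊤

/-- The generalized normal distribution `μ_p` on `ℝ`. -/
def muP (p : ℝ) : Measure ℝ :=
  volume.withDensity fun y =>
    ENNReal.ofReal ((2 * p ^ (1/p) * Real.Gamma (1 + 1/p))⁻¹ * Real.exp (-(|y| ^ p) / p))

/-- The uniform probability measure `μ_∞` on `[-1,1]`. -/
def muInf : Measure ℝ := (volume (Icc (-1:ℝ) 1))⁻¹ • volume.restrict (Icc (-1:ℝ) 1)

/-- Extended-real-valued log moment generating function of a measure on `ℝ`. -/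
def logM (γ : Measure ℝ) (t : ℝ) : EReal :=
  ENNReal.log (∫⁻ y, ENNReal.ofReal (Real.exp (t * y)) ∂γ)

/-- The class `𝒯_q` of measures whose log mgf is dominated by `C|t|^{q/(q-1)} + C`. -/
def memT (q : ℝ) (γ : Measure ℝ) : Prop :=
  ∃ C : ℝ, ∀ t : ℝ, logM γ t ≤ ((C * |t| ^ (q/(q-1)) + C : ℝ) : EReal)

/-- Legendre transform of a function of one real variable. -/
def legendre1 (Λ : ℝ → EReal) (τ : ℝ) : EReal := ⨆ t : ℝ, ((t * τ : ℝ) : EReal) - Λ t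

/-- Legendre transform of a function of two real variables. -/
def legendre2 (Λ : ℝ × ℝ → EReal) (τ : ℝ × ℝ) : EReal :=
  ⨆ t : ℝ × ℝ, ((t.1 * τ.1 + t.2 * τ.2 : ℝ) : EReal) - Λ t

/-- Legendre transform of a function of three real variables. -/
def legendre3 (Λ : ℝ × ℝ × ℝ → EReal) (τ : ℝ × ℝ × ℝ) : EReal :=
  ⨆ t : ℝ × ℝ × ℝ, ((t.1 * τ.1 + t.2.1 * τ.2.1 + t.2.2 * τ.2.2 : ℝ) : EReal) - Λ t

/-- `Φ_p(t₀,t₁,t₂) = log ∫∫ exp(t₀ z² + t₁ z y + t₂ |y|^p) μ₂(dz) μ_p(dy)`. -/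
def Phi (p : ℝ) (t : ℝ × ℝ × ℝ) : EReal :=
  ENNReal.log (∫⁻ y, (∫⁻ z,
    ENNReal.ofReal (Real.exp (t.1 * z^2 + t.2.1 * z * y + t.2.2 * |y| ^ p)) ∂(muP 2)) ∂(muP p))

/-- The annealed rate function `𝕀ᵃ_p` for `p ∈ [2,∞)`. -/
def Ia (p : ℝ) (w : ℝ) : EReal :=
  ⨅ τ ∈ {τ : ℝ × ℝ × ℝ | 0 < τ.1 ∧ 0 < τ.2.2 ∧
      τ.1 ^ (-(1:ℝ)/2) * τ.2.1 * τ.2.2 ^ (-(1:ℝ)/p) = w},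
    legendre3 (Phi p) τ

/-- `Λ_p(t₁,t₂) = log ∫ exp(t₁ y + t₂|y|^p) μ_p(dy)`. -/
def LamP (p : ℝ) (t : ℝ × ℝ) : EReal :=
  ENNReal.log (∫⁻ y, ENNReal.ofReal (Real.exp (t.1 * y + t.2 * |y| ^ p)) ∂(muP p))

/-- `Ψ_{p,ν}(t₁,t₂) = ∫ Λ_p(t₁ u, t₂) ν(du)`. -/
def Psi (p : ℝ) (ν : Measure ℝ) (t : ℝ × ℝ) : EReal :=
  eIntegral ν (fun u => LamP p (t.1 * u, t.2))

/-- The quenched rate function `𝕀^q_{p,ν}`. -/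
def Iq (p : ℝ) (ν : Measure ℝ) (w : ℝ) : EReal :=
  ⨅ τ ∈ {τ : ℝ × ℝ | 0 < τ.2 ∧ τ.1 * τ.2 ^ (-(1:ℝ)/p) = w}, legendre2 (Psi p ν) τ

/-- The Cramér-type rate function `𝕀^{cr}_p`. -/
def Icr (p : ℝ) (w : ℝ) : EReal :=
  ⨅ τ ∈ {τ : ℝ × ℝ | 0 < τ.2 ∧ τ.1 * τ.2 ^ (-(1:ℝ)/p) = w}, legendre2 (LamP p) τ

/-- `Φ_γ(t₀,t₁) = log ∫∫ exp(t₀ z² + t₁ z x) μ₂(dz) γ(dx)`. -/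
def Phig (γ : Measure ℝ) (t : ℝ × ℝ) : EReal :=
  ENNReal.log (∫⁻ x, (∫⁻ z,
    ENNReal.ofReal (Real.exp (t.1 * z^2 + t.2 * z * x)) ∂(muP 2)) ∂γ)

/-- The annealed rate function `𝕀ᵃ_γ` for a product measure `γ^{⊗n}`. -/
def Iag (γ : Measure ℝ) (w : ℝ) : EReal :=
  ⨅ τ ∈ {τ : ℝ × ℝ | 0 < τ.1 ∧ τ.1 ^ (-(1:ℝ)/2) * τ.2 = w}, legendre2 (Phig γ) τ

/-- `Ψ_{γ,ν}(t) = ∫ log M_γ(t u) ν(du)`. -/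
def Psig (γ ν : Measure ℝ) (t : ℝ) : EReal := eIntegral ν (fun u => logM γ (t * u))

/-- The quenched rate function `𝕀^q_{γ,ν}` for a product measure. -/
def Iqg (γ ν : Measure ℝ) : ℝ → EReal := legendre1 (Psig γ ν)

/-- `Ψ_{∞,ν}`. -/
def PsiInf (ν : Measure ℝ) : ℝ → EReal := Psig muInf ν

/-- `𝕀^q_{∞,ν}`. -/
def IqInf (ν : Measure ℝ) : ℝ → EReal := legendre1 (PsiInf ν)

/-- `𝕀ᵃ_∞`. -/
def IaInf : ℝ → EReal := Iag muInf

/-- Euclidean inner product on `ℝⁿ`. -/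
def dotp {n : ℕ} (x y : Fin n → ℝ) : ℝ := ∑ i, x i * y i

/-- The unit ℓ^p ball of `ℝⁿ`. -/
def lpBall (n : ℕ) (p : ℝ) : Set (Fin n → ℝ) := {x | ∑ i, |x i| ^ p ≤ 1}

/-- The uniform probability measure on the unit ℓ^p ball. -/
def uniformLpBall (n : ℕ) (p : ℝ) : Measure (Fin n → ℝ) :=
  (volume (lpBall n p))⁻¹ • volume.restrict (lpBall n p)

/-- The unit Euclidean sphere in `ℝⁿ`. -/
def unitSphereSet (n : ℕ) : Set (Fin n → ℝ) := {x | ∑ i, (x i)^2 = 1}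

/-- `μ` is the (unique) rotation-invariant probability measure on the unit sphere `S^{n-1}`. -/
def IsUniformSphere {n : ℕ} (μ : Measure (Fin n → ℝ)) : Prop :=
  IsProbabilityMeasure μ ∧ μ (unitSphereSet n) = 1 ∧
    ∀ O : Matrix.orthogonalGroup (Fin n) ℝ,
      Measure.map (fun x => (O : Matrix (Fin n) (Fin n) ℝ).mulVec x) μ = μ

/-- A large deviation principle with speed `s` and rate function `I`. -/
def IsLDP {Ω : Type*} [MeasurableSpace Ω] (P : Measure Ω)
    (ξ : ℕ → Ω → ℝ) (s : ℕ → ℝ) (I : ℝ → EReal) : Prop :=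
  LowerSemicontinuous I ∧
    ∀ Γ : Set ℝ, MeasurableSet Γ →
      (-(⨅ x ∈ interior Γ, I x) ≤
        atTop.liminf fun n =>
          (((s n)⁻¹ : ℝ) : EReal) * ENNReal.log (P {ω | ξ n ω ∈ interior Γ})) ∧
      ((atTop.limsup fun n =>
          (((s n)⁻¹ : ℝ) : EReal) * ENNReal.log (P {ω | ξ n ω ∈ closure Γ})) ≤
        -(⨅ x ∈ closure Γ, I x))

/-- Goodness of a rate function: compact sublevel sets. -/
def HasCompactSublevels (I : ℝ → EReal) : Prop := ∀ c : ℝ, IsCompact {x | I x ≤ (c : EReal)}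

/-- Quasiconvexity: convex sublevel sets. -/
def QuasiconvexRate (I : ℝ → EReal) : Prop := ∀ c : EReal, Convex ℝ {x | I x ≤ c}

/-- Symmetry: `I(-w) = I(w)`. -/
def SymmetricRate (I : ℝ → EReal) : Prop := ∀ w : ℝ, I (-w) = I w

/-- Convexity of an extended-real-valued rate function. -/
def ConvexRate (I : ℝ → EReal) : Prop :=
  ∀ x y a b : ℝ, 0 ≤ a → 0 ≤ b → a + b = 1 →
    I (a * x + b * y) ≤ (a : EReal) * I x + (b : EReal) * I y

/-- Convexity on a set, for extended-real-valued functions. -/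
def ConvexOnE (s : Set ℝ) (g : ℝ → EReal) : Prop :=
  ∀ x ∈ s, ∀ y ∈ s, ∀ a b : ℝ, 0 ≤ a → 0 ≤ b → a + b = 1 →
    g (a * x + b * y) ≤ (a : EReal) * g x + (b : EReal) * g y

/-- Concavity on a set, for extended-real-valued functions. -/
def ConcaveOnE (s : Set ℝ) (g : ℝ → EReal) : Prop :=
  ∀ x ∈ s, ∀ y ∈ s, ∀ a b : ℝ, 0 ≤ a → 0 ≤ b → a + b = 1 →
    (a : EReal) * g x + (b : EReal) * g y ≤ g (a * x + b * y)

/-- Strict convexity, for extended-real-valued functions. -/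
def StrictConvexE (g : ℝ → EReal) : Prop :=
  ∀ x y : ℝ, x ≠ y → ∀ a b : ℝ, 0 < a → 0 < b → a + b = 1 →
    g (a * x + b * y) < (a : EReal) * g x + (b : EReal) * g y

/-- The property of agreeing with a real affine function on a set. -/
def AffineOnE (s : Set ℝ) (g : ℝ → EReal) : Prop :=
  ∃ m q : ℝ, ∀ t ∈ s, g t = ((m * t + q : ℝ) : EReal)

/-- Empirical measure `L_{n,θ} = (1/n) Σ δ_{√n θ_i}`. -/
def empMeas (n : ℕ) (θn : Fin n → ℝ) : Measure ℝ :=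
  ((n : ℝ≥0∞))⁻¹ • ∑ i : Fin n, Measure.dirac (Real.sqrt n * θn i)

end LDP

namespace LDP

/-- The normalizing constant of the density of `muP p`. -/
def muPConst (p : ℝ) : ℝ := (2 * p ^ (1/p) * Real.Gamma (1 + 1/p))⁻¹

lemma muPConst_pos {p : ℝ} (hp : 2 ≤ p) : 0 < muPConst p := by
  have hp0 : 0 < p := by linarith
  have : 0 < Real.Gamma (1 + 1/p) := Real.Gamma_pos_of_pos (by positivity)
  unfold muPConst
  positivity

lemma muP_eq (p : ℝ) : muP p = volume.withDensity fun y =>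
    ENNReal.ofReal (muPConst p * Real.exp (-(|y| ^ p) / p)) := rfl

lemma measurable_muP_density (p : ℝ) : Measurable fun y : ℝ =>
    ENNReal.ofReal (muPConst p * Real.exp (-(|y| ^ p) / p)) := by
  fun_prop

lemma integral_exp_neg_mul_abs_rpow {p b : ℝ} (hp : 0 < p) (hb : 0 < b) :
    ∫ y : ℝ, Real.exp (-b * |y| ^ p) = 2 * (b ^ (-1 / p) * Real.Gamma (1 / p + 1)) := by
  rw [integral_comp_abs (f := fun y => Real.exp (-b * y ^ p)), integral_exp_neg_mul_rpow hp hb]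

lemma integrable_exp_neg_mul_abs_rpow {p b : ℝ} (hp : 0 < p) (hb : 0 < b) :
    Integrable fun y : ℝ => Real.exp (-b * |y| ^ p) := by
  by_contra h
  have h1 := integral_exp_neg_mul_abs_rpow hp hb
  rw [integral_undef h] at h1
  have : 0 < Real.Gamma (1/p + 1) := Real.Gamma_pos_of_pos (by positivity)
  have : 0 < 2 * (b ^ (-1 / p) * Real.Gamma (1 / p + 1)) := by positivity
  linarith

lemma isProbabilityMeasure_muP {p : ℝ} (hp : 2 ≤ p) : IsProbabilityMeasure (muP p) := by
  have hp0 : 0 < p := by linarith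
  constructor
  rw [muP_eq, withDensity_apply _ MeasurableSet.univ, Measure.restrict_univ]
  have h1 : ∀ y : ℝ, -(|y| ^ p) / p = -(1/p) * |y| ^ p := fun y => by ring
  simp_rw [h1]
  have hb : 0 < 1 / p := by positivity
  rw [← ofReal_integral_eq_lintegral_ofReal
    ((integrable_exp_neg_mul_abs_rpow hp0 hb).const_mul _)
    (ae_of_all _ fun y => mul_nonneg (muPConst_pos hp).le (Real.exp_pos _).le),
    integral_const_mul, integral_exp_neg_mul_abs_rpow hp0 hb]
  have hG : 0 < Real.Gamma (1/p + 1) := Real.Gamma_pos_of_pos (by positivity)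
  rw [muPConst, add_comm 1 (1/p), neg_div, Real.rpow_neg hb.le, one_div p,
    Real.inv_rpow hp0.le, inv_inv]
  have : 0 < p ^ p⁻¹ := by positivity
  rw [one_div] at hG
  rw [← ENNReal.ofReal_one]
  congr 1
  field_simp

lemma muP_absolutelyContinuous (p : ℝ) : muP p ≪ (volume : Measure ℝ) :=
  withDensity_absolutelyContinuous _ _

lemma muP_two : muP 2 = gaussianReal 0 1 := by
  rw [gaussianReal_of_var_ne_zero _ one_ne_zero, muP_eq]
  congr 1
  funext y
  rw [gaussianPDF, gaussianPDFReal, muPConst]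
  congr 2
  · have h1 : Real.Gamma (1 + 1/2) = √Real.pi / 2 := by
      rw [add_comm, Real.Gamma_add_one (by norm_num), Real.Gamma_one_half_eq]; ring
    rw [h1, ← Real.sqrt_eq_rpow, NNReal.coe_one, mul_one, Real.sqrt_mul (by norm_num)]
    congr 1; ring
  · rw [Real.rpow_two, sq_abs, sub_zero, NNReal.coe_one, mul_one]

lemma lintegral_muP {p : ℝ} (hp : 2 ≤ p) (f : ℝ → ℝ) (hf : Measurable f) :
    ∫⁻ y, ENNReal.ofReal (Real.exp (f y)) ∂(muP p) =
      ENNReal.ofReal (muPConst p) * ∫⁻ y, ENNReal.ofReal (Real.exp (f y - |y| ^ p / p)) := by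
  rw [muP_eq, lintegral_withDensity_eq_lintegral_mul _ (measurable_muP_density p)
    (by fun_prop), ← lintegral_const_mul _ (by fun_prop)]
  refine lintegral_congr fun y => ?_
  have := muPConst_pos hp
  simp only [Pi.mul_apply]
  rw [← ENNReal.ofReal_mul (by positivity), ← ENNReal.ofReal_mul' (by positivity), mul_assoc,
    ← Real.exp_add]
  congr 3
  ring

lemma integrable_exp_abs_rpow_muP {p b : ℝ} (hp : 2 ≤ p) (hb : b < 1 / p) :
    Integrable (fun y : ℝ => Real.exp (b * |y| ^ p)) (muP p) := by
  have hp0 : 0 < p := by linarith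
  refine ⟨(by fun_prop : Measurable _).aestronglyMeasurable, ?_⟩
  rw [hasFiniteIntegral_iff_ofReal (ae_of_all _ fun y => (Real.exp_pos _).le),
    lintegral_muP hp _ (by fun_prop)]
  refine ENNReal.mul_lt_top ENNReal.ofReal_lt_top ?_
  have h := (integrable_exp_neg_mul_abs_rpow hp0 (sub_pos.2 hb)).2
  rw [hasFiniteIntegral_iff_ofReal (ae_of_all _ fun y => (Real.exp_pos _).le)] at h
  convert h using 5
  ring

/-- The exponent `t₀ z² + t₁ z y + t₂ |y|^p` as a function of the pair `(y, z)`. -/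
def expo (p : ℝ) (t : ℝ × ℝ × ℝ) (x : ℝ × ℝ) : ℝ :=
  t.1 * x.2 ^ 2 + t.2.1 * x.2 * x.1 + t.2.2 * |x.1| ^ p

/-- The law of an independent pair `(Y, Z)` with `Y ∼ μ_p` and `Z ∼ μ₂`. -/
def pairLaw (p : ℝ) : Measure (ℝ × ℝ) := (muP p).prod (muP 2)

@[fun_prop]
lemma measurable_expo (p : ℝ) (t : ℝ × ℝ × ℝ) : Measurable (expo p t) := by
  unfold expo; fun_prop

lemma isProbabilityMeasure_pairLaw {p : ℝ} (hp : 2 ≤ p) :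
    IsProbabilityMeasure (pairLaw p) := by
  have := isProbabilityMeasure_muP hp
  have := isProbabilityMeasure_muP le_rfl
  unfold pairLaw; infer_instance

lemma Phi_eq {p : ℝ} (t : ℝ × ℝ × ℝ) :
    Phi p t = ENNReal.log (∫⁻ x, ENNReal.ofReal (Real.exp (expo p t x)) ∂(pairLaw p)) := by
  have := isProbabilityMeasure_muP le_rfl
  rw [pairLaw, lintegral_prod _ (by fun_prop)]
  rfl

/-- Parameters whose exponent is strictly dominated by `z² / 2 + |y|^p / p`. -/
def Admissible (p : ℝ) (t : ℝ × ℝ × ℝ) : Prop :=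
  ∃ δ > 0, ∃ C : ℝ, ∀ y z : ℝ,
    t.1 * z ^ 2 + t.2.1 * z * y + t.2.2 * |y| ^ p ≤
      (1 / 2 - δ) * z ^ 2 + (1 / p - δ) * |y| ^ p + C

lemma Admissible.integrable {p : ℝ} (hp : 2 ≤ p) {t : ℝ × ℝ × ℝ} (ht : Admissible p t) :
    Integrable (fun x => Real.exp (expo p t x)) (pairLaw p) := by
  obtain ⟨δ, hδ, C, h⟩ := ht
  have := isProbabilityMeasure_muP hp
  have := isProbabilityMeasure_muP le_rfl
  have h1 := integrable_exp_abs_rpow_muP hp (b := 1 / p - δ) (by linarith)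
  have h2 := integrable_exp_abs_rpow_muP le_rfl (b := 1 / 2 - δ) (by linarith)
  refine ((h1.mul_prod h2).const_mul (Real.exp C)).mono'
    (by fun_prop : Measurable _).aestronglyMeasurable (ae_of_all _ fun x => ?_)
  rw [Real.norm_of_nonneg (Real.exp_pos _).le, ← Real.exp_add, ← Real.exp_add]
  refine Real.exp_le_exp.2 ((h x.1 x.2).trans ?_)
  rw [Real.rpow_two, sq_abs]
  linarith

lemma sq_le_one_add_abs_rpow {p : ℝ} (hp : 2 ≤ p) (y : ℝ) : y ^ 2 ≤ 1 + |y| ^ p := by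
  rcases le_total |y| 1 with h | h
  · have h0 : 0 ≤ |y| ^ p := by positivity
    have : y ^ 2 ≤ 1 := by rw [← sq_abs]; exact pow_le_one₀ (abs_nonneg _) h
    linarith
  · have h1 := Real.rpow_le_rpow_of_exponent_le h hp
    rw [Real.rpow_two, sq_abs] at h1
    linarith

lemma exists_mul_sq_le {p : ℝ} (hp : 2 < p) {K ε : ℝ} (hK : 0 ≤ K) (hε : 0 < ε) :
    ∃ C : ℝ, ∀ y : ℝ, K * y ^ 2 ≤ ε * |y| ^ p + C := by
  have hp2 : 0 < p - 2 := by linarith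
  refine ⟨K * ((K / ε) ^ (1 / (p - 2))) ^ 2, fun y => ?_⟩
  have hR : 0 ≤ (K / ε) ^ (1 / (p - 2)) := by positivity
  rcases le_total |y| ((K / ε) ^ (1 / (p - 2))) with h | h
  · have h1 : |y| ^ 2 ≤ ((K / ε) ^ (1 / (p - 2))) ^ 2 := by gcongr
    rw [sq_abs] at h1
    have h2 : 0 ≤ ε * |y| ^ p := by positivity
    nlinarith
  · have h1 : ((K / ε) ^ (1 / (p - 2))) ^ (p - 2) ≤ |y| ^ (p - 2) := by gcongr
    rw [← Real.rpow_mul (by positivity), one_div_mul_cancel hp2.ne', Real.rpow_one,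
      div_le_iff₀ hε] at h1
    have h2 : |y| ^ p = |y| ^ (p - 2) * y ^ 2 := by
      rw [← sq_abs y, ← Real.rpow_two,
        ← Real.rpow_add_of_nonneg (abs_nonneg _) hp2.le (by norm_num)]
      congr 1; ring
    have h3 : K * y ^ 2 ≤ (|y| ^ (p - 2) * ε) * y ^ 2 := by gcongr
    have h4 : 0 ≤ K * ((K / ε) ^ (1 / (p - 2))) ^ 2 := by positivity
    rw [h2]
    linarith

lemma Admissible.perturb {p : ℝ} (hp : 2 ≤ p) {t : ℝ × ℝ × ℝ} (ht : Admissible p t)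
    (e : ℝ × ℝ × ℝ) : ∃ ε > 0, ∀ h : ℝ, |h| < ε →
      Admissible p (t.1 + h * e.1, t.2.1 + h * e.2.1, t.2.2 + h * e.2.2) := by
  obtain ⟨δ, hδ, C, H⟩ := ht
  set M := |e.1| + |e.2.1| + |e.2.2| with hM
  have hM0 : 0 ≤ M := by positivity
  refine ⟨δ / (2 * (M + 1)), by positivity, fun h hh => ⟨δ / 2, by positivity, C + δ / 2, ?_⟩⟩
  intro y z
  have h1 : |h| * M ≤ δ / 2 := by
    rw [lt_div_iff₀ (by positivity)] at hh
    nlinarith [abs_nonneg h]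
  have hy := sq_le_one_add_abs_rpow hp y
  set Y := |y| ^ p with hY
  have hY0 : 0 ≤ Y := by positivity
  have hS : 0 ≤ z ^ 2 + Y + 1 := by positivity
  have hzy : |z * y| ≤ z ^ 2 + Y + 1 := by
    rw [abs_mul]
    nlinarith [sq_abs z, sq_abs y, sq_nonneg (|z| - |y|), sq_nonneg z, sq_nonneg y]
  have h2 : e.1 * z ^ 2 + e.2.1 * (z * y) + e.2.2 * Y ≤ M * (z ^ 2 + Y + 1) ∧
      -(M * (z ^ 2 + Y + 1)) ≤ e.1 * z ^ 2 + e.2.1 * (z * y) + e.2.2 * Y := by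
    rw [and_comm, ← abs_le]
    refine (abs_add_three _ _ _).trans ?_
    rw [abs_mul e.1, abs_mul e.2.1, abs_mul e.2.2, abs_of_nonneg hY0, abs_of_nonneg (sq_nonneg z),
      hM, add_mul, add_mul]
    gcongr
    · linarith
    · nlinarith [sq_nonneg z]
  have h3 : h * (e.1 * z ^ 2 + e.2.1 * (z * y) + e.2.2 * Y) ≤ δ / 2 * (z ^ 2 + Y + 1) := by
    refine (le_abs_self _).trans ?_
    rw [abs_mul]
    calc |h| * |e.1 * z ^ 2 + e.2.1 * (z * y) + e.2.2 * Y|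
        ≤ |h| * (M * (z ^ 2 + Y + 1)) := by gcongr; exact abs_le.2 h2.symm
      _ = |h| * M * (z ^ 2 + Y + 1) := by ring
      _ ≤ _ := by gcongr
  have h4 := H y z
  dsimp only
  linarith

lemma lintegral_exp_eq_top_of_nonneg {f : ℝ → ℝ} (hf : ∀ y, 0 ≤ f y) :
    ∫⁻ y, ENNReal.ofReal (Real.exp (f y)) = ⊤ := by
  have h : ∫⁻ _ : ℝ, (1 : ℝ≥0∞) ≤ ∫⁻ y, ENNReal.ofReal (Real.exp (f y)) := by
    refine lintegral_mono fun y => ?_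
    rw [← ENNReal.ofReal_one]
    exact ENNReal.ofReal_le_ofReal (Real.one_le_exp (hf y))
  simpa using h

lemma lintegral_exp_quadratic_eq_top {a : ℝ} (ha : 0 ≤ a) (b c : ℝ) :
    ∫⁻ z, ENNReal.ofReal (Real.exp (a * z ^ 2 + b * z + c)) = ⊤ := by
  obtain ⟨S, hS, hSb⟩ : ∃ S : Set ℝ, volume S = ⊤ ∧ MeasurableSet S ∧ ∀ z ∈ S, 0 ≤ b * z := by
    rcases le_total 0 b with h | h
    · exact ⟨Ioi 0, by simp, measurableSet_Ioi, fun z hz => mul_nonneg h (le_of_lt hz)⟩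
    · exact ⟨Iio 0, by simp, measurableSet_Iio, fun z hz =>
        mul_nonneg_of_nonpos_of_nonpos h (le_of_lt hz)⟩
  have h : ∫⁻ _ in S, ENNReal.ofReal (Real.exp c) ≤
      ∫⁻ z in S, ENNReal.ofReal (Real.exp (a * z ^ 2 + b * z + c)) := by
    refine setLIntegral_mono (by fun_prop) fun z hz => ?_
    have := hSb.2 z hz
    have h2 : 0 ≤ a * z ^ 2 := by positivity
    exact ENNReal.ofReal_le_ofReal (Real.exp_le_exp.2 (by linarith))
  have h1 : ∫⁻ _ in S, ENNReal.ofReal (Real.exp c) = ⊤ := by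
    rw [setLIntegral_const, hS, ENNReal.mul_top]
    simp [Real.exp_pos]
  rw [h1, top_le_iff] at h
  exact top_le_iff.1 (h.symm.le.trans (setLIntegral_le_lintegral _ _))

lemma lintegral_exp_quadratic {a : ℝ} (ha : 0 < a) (b c : ℝ) :
    ∫⁻ z, ENNReal.ofReal (Real.exp (-a * z ^ 2 + b * z + c)) =
      ENNReal.ofReal (Real.exp (b ^ 2 / (4 * a) + c)) *
        ∫⁻ z : ℝ, ENNReal.ofReal (Real.exp (-a * z ^ 2)) := by
  rw [← lintegral_sub_right_eq_self (fun z : ℝ => ENNReal.ofReal (Real.exp (-a * z ^ 2)))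
    (b / (2 * a)), ← lintegral_const_mul _ (by fun_prop)]
  refine lintegral_congr fun z => ?_
  rw [← ENNReal.ofReal_mul (Real.exp_pos _).le, ← Real.exp_add]
  congr 2
  field_simp
  ring

lemma lintegral_exp_gaussian_ne_zero (a : ℝ) :
    ∫⁻ z : ℝ, ENNReal.ofReal (Real.exp (-a * z ^ 2)) ≠ 0 := by
  rw [Ne, lintegral_eq_zero_iff (by fun_prop)]
  intro h
  have h2 : ∀ᵐ _ : ℝ, False := by
    filter_upwards [h] with z hz
    simp only [Pi.zero_apply, ENNReal.ofReal_eq_zero] at hz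
    exact absurd hz (not_le.2 (Real.exp_pos _))
  rw [eventually_false_iff_eq_bot, ae_eq_bot] at h2
  exact NeZero.ne (volume : Measure ℝ) h2

lemma admissible_of_Phi_ne_top {p : ℝ} (hp : 2 ≤ p) {t : ℝ × ℝ × ℝ} (ht : Phi p t ≠ ⊤) :
    Admissible p t := by
  have hp0 : 0 < p := by linarith
  have := isProbabilityMeasure_muP hp
  obtain ⟨t0, t1, t2⟩ := t
  have hc2 : ENNReal.ofReal (muPConst 2) ≠ 0 := by simpa using muPConst_pos le_rfl
  have hcp : ENNReal.ofReal (muPConst p) ≠ 0 := by simpa using muPConst_pos hp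
  have inner : ∀ y : ℝ, ∫⁻ z, ENNReal.ofReal
      (Real.exp (t0 * z ^ 2 + t1 * z * y + t2 * |y| ^ p)) ∂(muP 2) =
      ENNReal.ofReal (muPConst 2) * ∫⁻ z, ENNReal.ofReal
        (Real.exp (-(1 / 2 - t0) * z ^ 2 + (t1 * y) * z + t2 * |y| ^ p)) := by
    intro y
    rw [lintegral_muP le_rfl _ (by fun_prop)]
    congr 1
    refine lintegral_congr fun z => ?_
    rw [Real.rpow_two, sq_abs]
    congr 2
    ring
  rw [Phi, Ne, ENNReal.log_eq_top_iff] at ht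
  simp only [inner] at ht
  set a := 1 / 2 - t0 with ha_def
  have ha : 0 < a := by
    by_contra h
    apply ht
    have : ∀ y : ℝ, ENNReal.ofReal (muPConst 2) * ∫⁻ z, ENNReal.ofReal
        (Real.exp (-a * z ^ 2 + (t1 * y) * z + t2 * |y| ^ p)) = ⊤ := fun y => by
      rw [lintegral_exp_quadratic_eq_top (by linarith), ENNReal.mul_top hc2]
    simp only [this]
    simp
  set b := 1 / p - t2 with hb_def
  set c := t1 ^ 2 / (4 * a) with hc_def
  have hc : 0 ≤ c := by positivity
  have hfin : ∫⁻ y, ENNReal.ofReal (Real.exp (c * y ^ 2 - b * |y| ^ p)) ≠ ⊤ := by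
    intro h
    apply ht
    have h1 : ∀ y : ℝ, ENNReal.ofReal (muPConst 2) * ∫⁻ z, ENNReal.ofReal
        (Real.exp (-a * z ^ 2 + (t1 * y) * z + t2 * |y| ^ p)) =
        (ENNReal.ofReal (muPConst 2) * ∫⁻ z : ℝ, ENNReal.ofReal (Real.exp (-a * z ^ 2))) *
          ENNReal.ofReal (Real.exp (c * y ^ 2 + t2 * |y| ^ p)) := fun y => by
      rw [lintegral_exp_quadratic ha, mul_assoc]
      congr 1
      rw [mul_comm, mul_pow, hc_def]
      congr 4
      ring
    simp only [h1]
    rw [lintegral_const_mul _ (by fun_prop), lintegral_muP hp _ (by fun_prop)]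
    have h2 : ∀ y : ℝ, c * y ^ 2 + t2 * |y| ^ p - |y| ^ p / p = c * y ^ 2 - b * |y| ^ p :=
      fun y => by rw [hb_def]; ring
    simp only [h2, h]
    rw [ENNReal.mul_top hcp, ENNReal.mul_top]
    exact mul_ne_zero hc2 (lintegral_exp_gaussian_ne_zero a)
  rcases hp.eq_or_lt with rfl | hp2
  · have hbc : c < b := by
      by_contra h
      refine hfin (lintegral_exp_eq_top_of_nonneg fun y => ?_)
      rw [Real.rpow_two, sq_abs, ← sub_mul]
      exact mul_nonneg (by linarith) (sq_nonneg y)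
    have hb : 0 < b := by linarith
    rw [hc_def, div_lt_iff₀ (by positivity)] at hbc
    refine ⟨(4 * a * b - t1 ^ 2) / (4 * (a + b)), div_pos (by linarith) (by positivity), 0,
      fun y z => ?_⟩
    set δ := (4 * a * b - t1 ^ 2) / (4 * (a + b)) with hδ
    have hδ' : δ * (4 * (a + b)) = 4 * a * b - t1 ^ 2 := by
      rw [hδ]; field_simp
    have had : 0 < a - δ := by
      have : δ * (4 * (a + b)) < a * (4 * (a + b)) := by nlinarith [sq_nonneg t1]
      have := lt_of_mul_lt_mul_right this (by positivity)
      linarith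
    have key : 0 ≤ (a - δ) * z ^ 2 - t1 * z * y + (b - δ) * y ^ 2 := by
      have h1 : 0 ≤ (4 * (a - δ)) * ((a - δ) * z ^ 2 - t1 * z * y + (b - δ) * y ^ 2) := by
        have : (4 * (a - δ)) * ((a - δ) * z ^ 2 - t1 * z * y + (b - δ) * y ^ 2) =
            (2 * (a - δ) * z - t1 * y) ^ 2 + (2 * δ * y) ^ 2 := by
          linear_combination (-y ^ 2) * hδ'
        rw [this]; positivity
      exact nonneg_of_mul_nonneg_right h1 (by positivity)
    dsimp only
    rw [Real.rpow_two, sq_abs]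
    have e1 : t0 = 1 / 2 - a := by rw [ha_def]; ring
    have e2 : t2 = 1 / 2 - b := by rw [hb_def]; ring
    rw [e1, e2]
    linarith
  · have hb : 0 < b := by
      by_contra h
      refine hfin (lintegral_exp_eq_top_of_nonneg fun y => ?_)
      have : 0 ≤ |y| ^ p := by positivity
      nlinarith [mul_nonneg hc (sq_nonneg y)]
    obtain ⟨C, hC⟩ := exists_mul_sq_le hp2 (K := t1 ^ 2 / (2 * a)) (ε := b / 2)
      (by positivity) (by positivity)
    refine ⟨min (a / 2) (b / 2), by positivity, C, fun y z => ?_⟩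
    have h1 := hC y
    set Y := |y| ^ p
    have hY : 0 ≤ Y := by positivity
    have hz := sq_nonneg z
    have h2 : t1 * z * y ≤ a / 2 * z ^ 2 + t1 ^ 2 / (2 * a) * y ^ 2 := by
      have : a / 2 * z ^ 2 + t1 ^ 2 / (2 * a) * y ^ 2 - t1 * z * y =
          (a * z - t1 * y) ^ 2 / (2 * a) := by
        field_simp; ring
      have h3 : 0 ≤ (a * z - t1 * y) ^ 2 / (2 * a) := by positivity
      linarith
    have h3 : min (a / 2) (b / 2) * z ^ 2 ≤ a / 2 * z ^ 2 := by gcongr; exact min_le_left _ _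
    have h4 : min (a / 2) (b / 2) * Y ≤ b / 2 * Y := by gcongr; exact min_le_right _ _
    have e1 : t0 = 1 / 2 - a := by rw [ha_def]; ring
    have e2 : t2 = 1 / p - b := by rw [hb_def]; ring
    dsimp only
    rw [e1, e2]
    linarith

section Minimizer

variable {V Ω : Type*} [NormedAddCommGroup V] [NormedSpace ℝ V]
  [MeasurableSpace Ω] {μ : Measure Ω} {ψ : Ω → V →ₗ[ℝ] ℝ}

lemma lintegral_exp_le_of_tendsto [FiniteDimensional ℝ V]
    (hψ : ∀ t, Measurable fun x => ψ x t) {u : ℕ → V} {t : V}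
    (hu : Tendsto u atTop (𝓝 t)) {c : ℝ≥0∞}
    (hc : ∀ᶠ n in atTop, ∫⁻ x, ENNReal.ofReal (Real.exp (ψ x (u n))) ∂μ ≤ c) :
    ∫⁻ x, ENNReal.ofReal (Real.exp (ψ x t)) ∂μ ≤ c := by
  have h1 : ∀ x, ENNReal.ofReal (Real.exp (ψ x t)) =
      liminf (fun n => ENNReal.ofReal (Real.exp (ψ x (u n)))) atTop := fun x => by
    refine (Tendsto.liminf_eq ?_).symm
    exact (ENNReal.continuous_ofReal.comp (Real.continuous_exp.comp
      (ψ x).continuous_of_finiteDimensional)).continuousAt.tendsto.comp hu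
  simp only [h1]
  refine (lintegral_liminf_le fun n => ?_).trans ?_
  · have := hψ (u n)
    fun_prop
  · exact (liminf_le_liminf hc).trans (by simp)

lemma lintegral_exp_smul_le_one [IsProbabilityMeasure μ] (hψ : ∀ t, Measurable fun x => ψ x t)
    {t : V} (ht : ∫⁻ x, ENNReal.ofReal (Real.exp (ψ x t)) ∂μ ≤ 1) {θ : ℝ} (h0 : 0 ≤ θ)
    (h1 : θ ≤ 1) : ∫⁻ x, ENNReal.ofReal (Real.exp (ψ x (θ • t))) ∂μ ≤ 1 := by
  have hm := hψ t
  calc ∫⁻ x, ENNReal.ofReal (Real.exp (ψ x (θ • t))) ∂μ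
      ≤ ∫⁻ x, (ENNReal.ofReal (1 - θ) +
          ENNReal.ofReal θ * ENNReal.ofReal (Real.exp (ψ x t))) ∂μ := by
        refine lintegral_mono fun x => ?_
        rw [← ENNReal.ofReal_mul h0, ← ENNReal.ofReal_add (by linarith) (by positivity)]
        refine ENNReal.ofReal_le_ofReal ?_
        have := convexOn_exp.2 (mem_univ (0 : ℝ)) (mem_univ (ψ x t)) (by linarith : 0 ≤ 1 - θ) h0
          (by ring)
        simpa using this
    _ = ENNReal.ofReal (1 - θ) + ENNReal.ofReal θ *
          ∫⁻ x, ENNReal.ofReal (Real.exp (ψ x t)) ∂μ := by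
        rw [lintegral_add_left (by fun_prop), lintegral_const_mul _ (by fun_prop)]
        simp
    _ ≤ ENNReal.ofReal (1 - θ) + ENNReal.ofReal θ * 1 := by gcongr
    _ = 1 := by
        rw [mul_one, ← ENNReal.ofReal_add (by linarith) h0]
        simp

lemma exists_lintegral_exp_smul_lt [IsProbabilityMeasure μ]
    (hψ : ∀ t, Measurable fun x => ψ x t) {e : V} (he : μ {x | ψ x e = 0} = 0)
    (hle : ∀ n : ℕ, ∫⁻ x, ENNReal.ofReal (Real.exp (ψ x ((n : ℝ) • e))) ∂μ ≤ 1)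
    {c : ℝ≥0∞} (hc : 0 < c) :
    ∃ t, ∫⁻ x, ENNReal.ofReal (Real.exp (ψ x t)) ∂μ < c := by
  have hmeas : ∀ n : ℕ, Measurable fun x => ENNReal.ofReal (Real.exp (ψ x ((n : ℝ) • e))) :=
    fun n => by have := hψ ((n : ℝ) • e); fun_prop
  have hfat : ∫⁻ x, liminf (fun n : ℕ => ENNReal.ofReal (Real.exp (ψ x ((n : ℝ) • e)))) atTop ∂μ
      ≤ 1 := by
    refine (lintegral_liminf_le hmeas).trans ?_
    exact (liminf_le_liminf (Eventually.of_forall hle)).trans (by simp)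
  have hfin := ae_lt_top (.liminf hmeas) (hfat.trans_lt ENNReal.one_lt_top).ne
  have hneg : ∀ᵐ x ∂μ, ψ x e < 0 := by
    have he' : ∀ᵐ x ∂μ, ψ x e ≠ 0 := by
      rw [ae_iff]; simpa using he
    filter_upwards [hfin, he'] with x hx hx0
    by_contra hpos
    have hpos : 0 < ψ x e := lt_of_le_of_ne (not_lt.1 hpos) hx0.symm
    refine hx.ne (Tendsto.liminf_eq ?_)
    refine ENNReal.tendsto_ofReal_atTop.comp (Real.tendsto_exp_atTop.comp ?_)
    simp only [map_smul, smul_eq_mul]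
    exact tendsto_natCast_atTop_atTop.atTop_mul_const hpos
  have hlim : Tendsto (fun n : ℕ => ∫⁻ x, ENNReal.ofReal (Real.exp (ψ x ((n : ℝ) • e))) ∂μ) atTop
      (𝓝 (∫⁻ _, 0 ∂μ)) := by
    refine tendsto_lintegral_of_dominated_convergence (fun _ => 1) hmeas (fun n => ?_) (by simp) ?_
    · filter_upwards [hneg] with x hx
      rw [← ENNReal.ofReal_one]
      refine ENNReal.ofReal_le_ofReal (Real.exp_le_one_iff.2 ?_)
      rw [map_smul, smul_eq_mul]
      exact mul_nonpos_of_nonneg_of_nonpos (Nat.cast_nonneg n) hx.le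
    · filter_upwards [hneg] with x hx
      rw [← ENNReal.ofReal_zero]
      refine (ENNReal.continuous_ofReal.tendsto 0).comp (Real.tendsto_exp_atBot.comp ?_)
      simp only [map_smul, smul_eq_mul]
      exact tendsto_natCast_atTop_atTop.atTop_mul_const_of_neg hx
  rw [lintegral_zero] at hlim
  obtain ⟨n, hn⟩ := (hlim.eventually_lt_const hc).exists
  exact ⟨_, hn⟩

/-- A Laplace functional which is bounded below by a positive constant attains its minimum,
provided no nonzero linear statistic charges zero. -/
lemma exists_minimizer_lintegral_exp [FiniteDimensional ℝ V] [IsProbabilityMeasure μ]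
    (hψ : ∀ t, Measurable fun x => ψ x t) (hnull : ∀ e, e ≠ 0 → μ {x | ψ x e = 0} = 0)
    {c : ℝ≥0∞} (hc : 0 < c) (hle : ∀ t, c ≤ ∫⁻ x, ENNReal.ofReal (Real.exp (ψ x t)) ∂μ) :
    ∃ t₀, ∀ t, ∫⁻ x, ENNReal.ofReal (Real.exp (ψ x t₀)) ∂μ ≤
      ∫⁻ x, ENNReal.ofReal (Real.exp (ψ x t)) ∂μ := by
  have := FiniteDimensional.proper_real V
  set G : V → ℝ≥0∞ := fun t => ∫⁻ x, ENNReal.ofReal (Real.exp (ψ x t)) ∂μ with hG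
  have hG0 : G 0 = 1 := by simp [hG]
  have hcoer : ∃ R : ℝ, 0 ≤ R ∧ ∀ t, R ≤ ‖t‖ → 1 < G t := by
    by_contra! hcon
    choose u hu1 hu2 using fun n : ℕ => hcon (n + 1 : ℝ) (by positivity)
    have hpos : ∀ n, 0 < ‖u n‖ := fun n => by
      have h1 := hu1 n
      have h2 : (0 : ℝ) ≤ n := Nat.cast_nonneg n
      linarith
    obtain ⟨e, he, φ, hφ, hlim⟩ := (isCompact_sphere (0 : V) 1).tendsto_subseq
      (x := fun n => ‖u n‖⁻¹ • u n) fun n => by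
        simp [norm_smul, inv_mul_cancel₀ (hpos n).ne']
    have he0 : e ≠ 0 := by
      rintro rfl
      simp at he
    have hray : ∀ k : ℕ, G ((k : ℝ) • e) ≤ 1 := by
      intro k
      refine lintegral_exp_le_of_tendsto hψ (hlim.const_smul (k : ℝ)) ?_
      filter_upwards [eventually_ge_atTop k] with n hn
      simp only [Function.comp_apply, smul_smul]
      refine lintegral_exp_smul_le_one hψ (hu2 (φ n)) (by positivity) ?_
      rw [← div_eq_mul_inv, div_le_one (hpos _)]
      have h1 := hu1 (φ n)
      have h2 : (k : ℝ) ≤ φ n := by exact_mod_cast hn.trans (hφ.id_le n)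
      linarith
    obtain ⟨t, ht⟩ := exists_lintegral_exp_smul_lt hψ (hnull e he0) hray hc
    exact absurd ht (not_lt.2 (hle t))
  obtain ⟨R, hR, hcoer⟩ := hcoer
  have hlsc : LowerSemicontinuous G := by
    rw [lowerSemicontinuous_iff_isClosed_preimage]
    intro y
    refine IsSeqClosed.isClosed fun v t hv hvt => ?_
    exact lintegral_exp_le_of_tendsto hψ hvt (Eventually.of_forall hv)
  obtain ⟨t₀, _, ht₀⟩ := (hlsc.lowerSemicontinuousOn _).exists_isMinOn
    ⟨0, Metric.mem_closedBall_self hR⟩ (isCompact_closedBall (0 : V) R)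
  refine ⟨t₀, fun t => ?_⟩
  by_cases ht : ‖t‖ ≤ R
  · exact ht₀ (by simpa using ht)
  · have h0 : G t₀ ≤ G 0 := ht₀ (by simpa using hR)
    rw [hG0] at h0
    exact h0.trans (hcoer t (not_le.1 ht).le).le

/-- First-order condition at a minimizer of a Laplace functional. -/
lemma integral_tilted_eq_zero_of_minimizer [IsProbabilityMeasure μ] {t₀ : V}
    (hint : ∀ e : V, ∃ ε > 0, ∀ h : ℝ, |h| < ε →
      Integrable (fun x => Real.exp (ψ x (t₀ + h • e))) μ)
    (hmin : ∀ t, ∫⁻ x, ENNReal.ofReal (Real.exp (ψ x t₀)) ∂μ ≤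
      ∫⁻ x, ENNReal.ofReal (Real.exp (ψ x t)) ∂μ) (e : V) :
    Integrable (fun x => ψ x e) (μ.tilted fun x => ψ x t₀) ∧
      ∫ x, ψ x e ∂(μ.tilted fun x => ψ x t₀) = 0 := by
  obtain ⟨ε, hε, hε'⟩ := hint e
  have h0 : Integrable (fun x => Real.exp (ψ x t₀)) μ := by
    have := hε' 0 (by simpa using hε)
    simpa using this
  set ρ := μ.tilted fun x => ψ x t₀ with hρ
  have hnhds : Ioo (-ε) ε ∈ 𝓝 (0 : ℝ) := Ioo_mem_nhds (by linarith) hε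
  have hint' : ∀ h ∈ Ioo (-ε) ε, Integrable (fun x => Real.exp (h * ψ x e)) ρ := by
    intro h hh
    rw [hρ, integrable_tilted_iff h0]
    convert hε' h (abs_lt.2 hh) using 2 with x
    rw [smul_eq_mul, ← Real.exp_add, map_add, map_smul, smul_eq_mul]
  have hinterior : (0 : ℝ) ∈ interior (integrableExpSet (fun x => ψ x e) ρ) :=
    mem_interior_iff_mem_nhds.2 (mem_of_superset hnhds hint')
  refine ⟨integrable_of_mem_interior_integrableExpSet hinterior, ?_⟩
  have hder := hasDerivAt_mgf hinterior
  simp only [zero_mul, Real.exp_zero, mul_one] at hder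
  refine IsLocalMin.hasDerivAt_eq_zero (f := mgf (fun x => ψ x e) ρ) ?_ hder
  have hpos : 0 < ∫ x, Real.exp (ψ x t₀) ∂μ := integral_exp_pos h0
  have hmgf : ∀ h : ℝ, mgf (fun x => ψ x e) ρ h =
      (∫ x, Real.exp (ψ x (t₀ + h • e)) ∂μ) / ∫ x, Real.exp (ψ x t₀) ∂μ := by
    intro h
    rw [mgf, hρ, integral_exp_tilted]
    simp
  filter_upwards [hnhds] with h hh
  rw [hmgf, hmgf, zero_smul, add_zero]
  refine div_le_div_of_nonneg_right ?_ hpos.le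
  have h1 := hmin (t₀ + h • e)
  have h2 := hε' h (abs_lt.2 hh)
  rw [← ofReal_integral_eq_lintegral_ofReal h0 (ae_of_all _ fun x => (Real.exp_pos _).le),
    ← ofReal_integral_eq_lintegral_ofReal h2 (ae_of_all _ fun x => (Real.exp_pos _).le)] at h1
  exact (ENNReal.ofReal_le_ofReal_iff (integral_exp_pos h2).le).1 h1

end Minimizer

lemma erealToENNReal_coe (x : ℝ) : erealToENNReal (x : EReal) = ENNReal.ofReal x := by
  simp [erealToENNReal]

lemma erealToENNReal_mono : Monotone erealToENNReal := fun _ _ h =>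
  EReal.toENNReal_le_toENNReal h

lemma eIntegral_mono_ae {ν : Measure ℝ} {f g : ℝ → EReal} (h : ∀ᵐ u ∂ν, f u ≤ g u) :
    eIntegral ν f ≤ eIntegral ν g := by
  unfold eIntegral
  refine EReal.sub_le_sub ?_ ?_
  · rw [EReal.coe_ennreal_le_coe_ennreal_iff]
    exact lintegral_mono_ae (h.mono fun u hu => erealToENNReal_mono hu)
  · rw [EReal.coe_ennreal_le_coe_ennreal_iff]
    exact lintegral_mono_ae (h.mono fun u hu => erealToENNReal_mono (EReal.neg_le_neg_iff.2 hu))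

lemma eIntegral_congr_ae {ν : Measure ℝ} {f g : ℝ → EReal} (h : f =ᵐ[ν] g) :
    eIntegral ν f = eIntegral ν g := by
  have h1 : ∫⁻ u, erealToENNReal (f u) ∂ν = ∫⁻ u, erealToENNReal (g u) ∂ν :=
    lintegral_congr_ae (h.fun_comp erealToENNReal)
  have h2 : ∫⁻ u, erealToENNReal (-f u) ∂ν = ∫⁻ u, erealToENNReal (-g u) ∂ν :=
    lintegral_congr_ae (h.fun_comp fun x => erealToENNReal (-x))
  rw [eIntegral, eIntegral, h1, h2]

lemma eIntegral_coe {ν : Measure ℝ} {f : ℝ → ℝ} (hf : Integrable f ν) :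
    eIntegral ν (fun u => (f u : EReal)) = ((∫ u, f u ∂ν : ℝ) : EReal) := by
  have h1 : ∫⁻ u, ENNReal.ofReal (f u) ∂ν ≠ ⊤ := hf.lintegral_lt_top.ne
  have h2 : ∫⁻ u, ENNReal.ofReal (-f u) ∂ν ≠ ⊤ := hf.neg.lintegral_lt_top.ne
  simp only [eIntegral, ← EReal.coe_neg, erealToENNReal_coe]
  rw [integral_eq_lintegral_pos_part_sub_lintegral_neg_part hf, EReal.coe_sub,
    EReal.coe_ennreal_toReal h1, EReal.coe_ennreal_toReal h2]

lemma ennreal_log_ofReal {x : ℝ} (hx : 0 < x) :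
    ENNReal.log (ENNReal.ofReal x) = ((Real.log x : ℝ) : EReal) := by
  rw [ENNReal.log_pos_real (by simpa using hx) ENNReal.ofReal_ne_top,
    ENNReal.toReal_ofReal hx.le]

lemma relEnt_eq_coe {ν μ : Measure ℝ} [SigmaFinite ν] [SigmaFinite μ] (hac : ν ≪ μ)
    (h : Integrable (llr ν μ) ν) : relEnt ν μ = ((∫ x, llr ν μ x ∂ν : ℝ) : EReal) := by
  rw [relEnt, if_pos hac, ← eIntegral_coe h]
  refine eIntegral_congr_ae ?_
  filter_upwards [Measure.rnDeriv_pos hac, hac.ae_le (Measure.rnDeriv_lt_top ν μ)] with x h1 h2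
  rw [ENNReal.log_pos_real h1.ne' h2.ne, llr]

lemma relEnt_eq_top_or {ν μ : Measure ℝ} [IsProbabilityMeasure ν] [IsProbabilityMeasure μ] :
    relEnt ν μ = ⊤ ∨ (ν ≪ μ ∧ Integrable (llr ν μ) ν) := by
  by_cases hac : ν ≪ μ
  swap; · exact Or.inl (if_neg hac)
  have hneg : ∫⁻ x, ENNReal.ofReal (-llr ν μ x) ∂ν ≠ ⊤ := by
    refine ne_top_of_le_ne_top ENNReal.one_ne_top ?_
    calc ∫⁻ x, ENNReal.ofReal (-llr ν μ x) ∂ν ≤ ∫⁻ x, (ν.rnDeriv μ x)⁻¹ ∂ν := by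
          refine lintegral_mono_ae ?_
          filter_upwards [Measure.rnDeriv_pos hac, hac.ae_le (Measure.rnDeriv_lt_top ν μ)]
            with x h1 h2
          have h3 := ENNReal.toReal_pos h1.ne' h2.ne
          rw [llr, ← Real.log_inv, ← ENNReal.toReal_inv]
          refine ENNReal.ofReal_le_of_le_toReal ?_
          exact (Real.log_le_sub_one_of_pos (by rw [ENNReal.toReal_inv]; positivity)).trans
            (by linarith)
      _ = ∫⁻ x, ν.rnDeriv μ x * (ν.rnDeriv μ x)⁻¹ ∂μ :=
          (lintegral_rnDeriv_mul hac (by fun_prop)).symm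
      _ ≤ ∫⁻ _, 1 ∂μ := lintegral_mono fun x => ENNReal.mul_inv_le_one _
      _ = 1 := by simp
  by_cases hpos : ∫⁻ x, ENNReal.ofReal (llr ν μ x) ∂ν = ⊤
  · left
    have hcongr : (fun x => ENNReal.log (ν.rnDeriv μ x)) =ᵐ[ν]
        fun x => ((llr ν μ x : ℝ) : EReal) := by
      filter_upwards [Measure.rnDeriv_pos hac, hac.ae_le (Measure.rnDeriv_lt_top ν μ)] with x h1 h2
      rw [ENNReal.log_pos_real h1.ne' h2.ne, llr]
    rw [relEnt, if_pos hac, eIntegral_congr_ae hcongr, eIntegral]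
    simp only [← EReal.coe_neg, erealToENNReal_coe, hpos]
    rw [EReal.coe_ennreal_top, ← EReal.coe_ennreal_toReal hneg, EReal.top_sub_coe]
  · refine Or.inr ⟨hac, (measurable_llr ν μ).aestronglyMeasurable, ?_⟩
    rw [hasFiniteIntegral_iff_norm]
    refine lt_of_le_of_lt ?_ (ENNReal.add_lt_top.2 ⟨Ne.lt_top hpos, Ne.lt_top hneg⟩)
    rw [← lintegral_add_left (by fun_prop)]
    refine lintegral_mono fun x => ?_
    rcases le_total 0 (llr ν μ x) with h | h
    · rw [Real.norm_of_nonneg h]; exact le_self_add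
    · rw [Real.norm_of_nonpos h]; exact le_add_self

lemma relEnt_self {μ : Measure ℝ} [IsProbabilityMeasure μ] : relEnt μ μ = 0 := by
  have h := llr_self μ
  have hint : Integrable (llr μ μ) μ := (integrable_congr h).2 (integrable_zero _ _ _)
  rw [relEnt_eq_coe Measure.AbsolutelyContinuous.rfl hint, integral_congr_ae h]
  simp

/-- Jensen's inequality for the exponential. -/
lemma integral_le_log_integral_exp {Ω : Type*} [MeasurableSpace Ω] {μ : Measure Ω}
    [IsProbabilityMeasure μ] {X : Ω → ℝ} (hX : Integrable X μ)
    (hexp : Integrable (fun x => Real.exp (X x)) μ) :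
    ∫ x, X x ∂μ ≤ Real.log (∫ x, Real.exp (X x) ∂μ) := by
  rw [Real.le_log_iff_exp_le (integral_exp_pos hexp)]
  exact convexOn_exp.map_integral_le Real.continuous_exp.continuousOn isClosed_univ
    (ae_of_all _ fun _ => mem_univ _) hX hexp

/-- The Donsker–Varadhan inequality. -/
lemma integral_sub_log_integral_exp_le {ν μ : Measure ℝ} [IsProbabilityMeasure ν]
    [IsProbabilityMeasure μ] (hac : ν ≪ μ) (hllr : Integrable (llr ν μ) ν) {g : ℝ → ℝ}
    (hg : Integrable g ν) (hexp : Integrable (fun x => Real.exp (g x)) μ) :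
    ∫ x, g x ∂ν - Real.log (∫ x, Real.exp (g x) ∂μ) ≤ ∫ x, llr ν μ x ∂ν := by
  have := isProbabilityMeasure_tilted hexp
  have h1 := integral_llr_tilted_right hac hg hexp hllr
  have h2 := InformationTheory.integral_llr_add_sub_measure_univ_nonneg
    (hac.trans (absolutelyContinuous_tilted hexp)) (integrable_llr_tilted_right hac hg hllr hexp)
  rw [h1] at h2
  simp at h2
  linarith

lemma mom_two {ν : Measure ℝ} : mom 2 ν = ∫⁻ x, ENNReal.ofReal (x ^ 2) ∂ν := by
  simp [mom]

lemma integrable_sq_of_mom {ν : Measure ℝ} (h : mom 2 ν ≤ 1) :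
    Integrable (fun x : ℝ => x ^ 2) ν := by
  refine ⟨by fun_prop, ?_⟩
  rw [hasFiniteIntegral_iff_ofReal (ae_of_all _ fun x => sq_nonneg x), ← mom_two]
  exact h.trans_lt ENNReal.one_lt_top

lemma mom_two_eq {ν : Measure ℝ} (h : Integrable (fun x : ℝ => x ^ 2) ν) :
    mom 2 ν = ENNReal.ofReal (∫ x, x ^ 2 ∂ν) := by
  rw [mom_two, ofReal_integral_eq_lintegral_ofReal h (ae_of_all _ fun x => sq_nonneg x)]

lemma mom_two_muP_two : mom 2 (muP 2) = 1 := by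
  have hint : Integrable (fun x : ℝ => x ^ 2) (gaussianReal 0 1) :=
    (memLp_id_gaussianReal 2).integrable_sq
  have h := variance_eq_sub (μ := gaussianReal 0 1) (X := id) (memLp_id_gaussianReal 2)
  rw [variance_id_gaussianReal] at h
  rw [muP_two, mom_two_eq hint]
  simp at h
  simp [← h]

section Slice

variable {p : ℝ} {t : ℝ × ℝ × ℝ}

/-- The real-valued logarithmic moment generating function
`log ∫ exp(t₁ z y + t₂ |y|^p) μ_p(dy)`. -/
def ell (p : ℝ) (t : ℝ × ℝ × ℝ) (z : ℝ) : ℝ :=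
  Real.log (∫ y, Real.exp (t.2.1 * z * y + t.2.2 * |y| ^ p) ∂(muP p))

lemma integrable_abs_rpow_muP (hp : 2 ≤ p) : Integrable (fun y : ℝ => |y| ^ p) (muP p) := by
  have hp0 : 0 < p := by linarith
  have h := (integrable_exp_abs_rpow_muP hp (b := 1 / (2 * p))
    (by gcongr; linarith)).const_mul (2 * p)
  refine h.mono' (by fun_prop : Measurable _).aestronglyMeasurable (ae_of_all _ fun y => ?_)
  rw [Real.norm_of_nonneg (by positivity)]
  have h1 := Real.add_one_le_exp (1 / (2 * p) * |y| ^ p)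
  calc |y| ^ p = 2 * p * (1 / (2 * p) * |y| ^ p) := by field_simp
    _ ≤ _ := by gcongr; linarith

lemma abs_le_two_add_abs_rpow (hp : 2 ≤ p) (y : ℝ) : |y| ≤ 2 + |y| ^ p := by
  have h := sq_le_one_add_abs_rpow hp y
  have h2 := sq_abs y
  nlinarith [sq_nonneg (|y| - 1), abs_nonneg y]

lemma integrable_id_muP (hp : 2 ≤ p) : Integrable (fun y : ℝ => y) (muP p) := by
  have := isProbabilityMeasure_muP hp
  refine ((integrable_const (2 : ℝ)).add (integrable_abs_rpow_muP hp)).mono'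
    (by fun_prop : Measurable _).aestronglyMeasurable (ae_of_all _ fun y => ?_)
  exact abs_le_two_add_abs_rpow hp y

lemma Admissible.integrable_slice (hp : 2 ≤ p) (ht : Admissible p t) (z : ℝ) :
    Integrable (fun y => Real.exp (t.2.1 * z * y + t.2.2 * |y| ^ p)) (muP p) := by
  obtain ⟨δ, hδ, C, h⟩ := ht
  have h1 := (integrable_exp_abs_rpow_muP hp (b := 1 / p - δ) (by linarith)).const_mul
    (Real.exp ((1 / 2 - δ - t.1) * z ^ 2 + C))
  refine h1.mono' (by fun_prop : Measurable _).aestronglyMeasurable (ae_of_all _ fun y => ?_)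
  rw [Real.norm_of_nonneg (Real.exp_pos _).le, ← Real.exp_add]
  refine Real.exp_le_exp.2 ?_
  linarith [h y z]

lemma Admissible.lamP_eq (hp : 2 ≤ p) (ht : Admissible p t) (z : ℝ) :
    LamP p (t.2.1 * z, t.2.2) = (ell p t z : EReal) := by
  have := isProbabilityMeasure_muP hp
  have h := ht.integrable_slice hp z
  rw [LamP, ← ofReal_integral_eq_lintegral_ofReal h (ae_of_all _ fun _ => (Real.exp_pos _).le),
    ennreal_log_ofReal (integral_exp_pos h), ell]

lemma Admissible.exp_ell (hp : 2 ≤ p) (ht : Admissible p t) (z : ℝ) :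
    Real.exp (ell p t z) = ∫ y, Real.exp (t.2.1 * z * y + t.2.2 * |y| ^ p) ∂(muP p) := by
  have := isProbabilityMeasure_muP hp
  rw [ell, Real.exp_log (integral_exp_pos (ht.integrable_slice hp z))]

@[fun_prop]
lemma measurable_ell (hp : 2 ≤ p) (t : ℝ × ℝ × ℝ) : Measurable (ell p t) := by
  have := isProbabilityMeasure_muP hp
  refine Real.measurable_log.comp ?_
  refine StronglyMeasurable.measurable (StronglyMeasurable.integral_prod_right'
    (f := fun x : ℝ × ℝ => Real.exp (t.2.1 * x.1 * x.2 + t.2.2 * |x.2| ^ p)) ?_)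
  exact (by fun_prop : Measurable _).stronglyMeasurable

lemma Admissible.exists_abs_ell_le (hp : 2 ≤ p) (ht : Admissible p t) :
    ∃ K, ∀ z, |ell p t z| ≤ K * (1 + z ^ 2) := by
  have := isProbabilityMeasure_muP hp
  have hslice := ht.integrable_slice hp
  have hI : ∀ z, Integrable (fun y => t.2.1 * z * y + t.2.2 * |y| ^ p) (muP p) := fun z =>
    ((integrable_id_muP hp).const_mul _).add ((integrable_abs_rpow_muP hp).const_mul _)
  have hlow : ∀ z, t.2.1 * z * (∫ y, y ∂(muP p)) + t.2.2 * (∫ y, |y| ^ p ∂(muP p)) ≤ ell p t z := by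
    intro z
    have h := integral_le_log_integral_exp (hI z) (hslice z)
    rwa [integral_add ((integrable_id_muP hp).const_mul _)
      ((integrable_abs_rpow_muP hp).const_mul _), integral_const_mul, integral_const_mul] at h
  obtain ⟨δ, hδ, C, h⟩ := ht
  have hb := integrable_exp_abs_rpow_muP hp (b := 1 / p - δ) (by linarith)
  set M := Real.log (∫ y, Real.exp ((1 / p - δ) * |y| ^ p) ∂(muP p)) with hM
  have hup : ∀ z, ell p t z ≤ (1 / 2 - δ - t.1) * z ^ 2 + C + M := by
    intro z
    rw [hM, ell, Real.log_le_iff_le_exp (integral_exp_pos (hslice z)), Real.exp_add,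
      Real.exp_log (integral_exp_pos hb), ← integral_const_mul]
    refine integral_mono (hslice z) (hb.const_mul _) fun y => ?_
    simp only
    rw [← Real.exp_add]
    refine Real.exp_le_exp.2 ?_
    linarith [h y z]
  set m1 := ∫ y, y ∂(muP p)
  set m2 := ∫ y, |y| ^ p ∂(muP p)
  refine ⟨|t.2.1 * m1| + |t.2.2 * m2| + |1 / 2 - δ - t.1| + |C + M|, fun z => ?_⟩
  have hz : |z| ≤ 1 + z ^ 2 := by nlinarith [sq_nonneg (|z| - 1), sq_abs z, abs_nonneg z]
  have hz2 := sq_nonneg z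
  have e1 : -(|t.2.1 * m1| * (1 + z ^ 2)) ≤ t.2.1 * z * m1 := by
    have : |t.2.1 * m1 * z| ≤ |t.2.1 * m1| * (1 + z ^ 2) := by rw [abs_mul]; gcongr
    linarith [(abs_le.1 this).1]
  have e2 := neg_abs_le (t.2.2 * m2)
  have e3 := le_abs_self (1 / 2 - δ - t.1)
  have e4 := le_abs_self (C + M)
  have a1 := abs_nonneg (t.2.1 * m1)
  have a2 := abs_nonneg (t.2.2 * m2)
  have a3 := abs_nonneg (1 / 2 - δ - t.1)
  have a4 := abs_nonneg (C + M)
  have l := hlow z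
  have u := hup z
  have b2 := mul_nonneg a2 hz2
  have b3 := mul_nonneg a3 hz2
  have b4 := mul_nonneg a4 hz2
  have b1 := mul_nonneg a1 hz2
  have c3 := mul_le_mul_of_nonneg_right e3 hz2
  rw [abs_le]
  constructor <;> nlinarith

lemma Admissible.integrable_ell (hp : 2 ≤ p) (ht : Admissible p t) {ν : Measure ℝ}
    [IsProbabilityMeasure ν] (hν : Integrable (fun z : ℝ => z ^ 2) ν) :
    Integrable (ell p t) ν := by
  obtain ⟨K, hK⟩ := ht.exists_abs_ell_le hp
  exact (((integrable_const (1 : ℝ)).add hν).const_mul K).mono'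
    (measurable_ell hp t).aestronglyMeasurable (ae_of_all _ hK)

lemma Admissible.psi_eq (hp : 2 ≤ p) (ht : Admissible p t) {ν : Measure ℝ}
    [IsProbabilityMeasure ν] (hν : Integrable (fun z : ℝ => z ^ 2) ν) :
    Psi p ν (t.2.1, t.2.2) = ((∫ z, ell p t z ∂ν : ℝ) : EReal) := by
  rw [← eIntegral_coe (ht.integrable_ell hp hν), Psi]
  simp only [ht.lamP_eq hp]

lemma Admissible.phi_eq (hp : 2 ≤ p) (ht : Admissible p t) :
    Phi p t = ((Real.log (∫ x, Real.exp (expo p t x) ∂(pairLaw p)) : ℝ) : EReal) := by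
  have := isProbabilityMeasure_pairLaw hp
  have h := ht.integrable hp
  rw [Phi_eq, ← ofReal_integral_eq_lintegral_ofReal h (ae_of_all _ fun _ => (Real.exp_pos _).le),
    ennreal_log_ofReal (integral_exp_pos h)]

lemma exp_expo (p : ℝ) (t x : _) : Real.exp (expo p t x) =
    Real.exp (t.1 * x.2 ^ 2) * Real.exp (t.2.1 * x.2 * x.1 + t.2.2 * |x.1| ^ p) := by
  rw [← Real.exp_add, expo, add_assoc]

lemma Admissible.integrable_exp_sq_add_ell (hp : 2 ≤ p) (ht : Admissible p t) :
    Integrable (fun z => Real.exp (t.1 * z ^ 2 + ell p t z)) (muP 2) := by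
  have := isProbabilityMeasure_muP hp
  have := isProbabilityMeasure_muP le_rfl
  convert (ht.integrable hp).integral_prod_right using 2 with z
  simp only [exp_expo]
  rw [integral_const_mul, Real.exp_add, ht.exp_ell hp]

lemma Admissible.integral_exp_sq_add_ell (hp : 2 ≤ p) (ht : Admissible p t) :
    ∫ z, Real.exp (t.1 * z ^ 2 + ell p t z) ∂(muP 2) =
      ∫ x, Real.exp (expo p t x) ∂(pairLaw p) := by
  have := isProbabilityMeasure_muP hp
  have := isProbabilityMeasure_muP le_rfl
  rw [pairLaw, integral_prod_symm _ (ht.integrable hp)]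
  refine integral_congr_ae (ae_of_all _ fun z => ?_)
  simp only [exp_expo]
  rw [integral_const_mul, Real.exp_add, ht.exp_ell hp]

lemma Admissible.fst_le (ht : Admissible p t) (hp : 2 ≤ p) : t.1 ≤ 1 / 2 := by
  obtain ⟨δ, hδ, C, h⟩ := ht
  by_contra! hcon
  have h1 := h 0 (Real.sqrt (|C| / δ + 1))
  rw [Real.sq_sqrt (by positivity)] at h1
  have h0 : |(0 : ℝ)| ^ p = 0 := by
    rw [abs_zero, Real.zero_rpow (by linarith)]
  rw [h0] at h1
  have h2 : δ * (|C| / δ + 1) = |C| + δ := by field_simp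
  have h3 : 0 < |C| / δ + 1 := by positivity
  have h4 := mul_pos (sub_pos.2 hcon) h3
  linarith [le_abs_self C]

end Slice

lemma legendre3_Phi_one_le {p : ℝ} (hp : 2 ≤ p) {ν : Measure ℝ} [IsProbabilityMeasure ν]
    (hmom : mom 2 ν ≤ 1) (hac : ν ≪ muP 2) (hllr : Integrable (llr ν (muP 2)) ν) (τ : ℝ × ℝ) :
    legendre3 (Phi p) (1, τ) ≤ legendre2 (Psi p ν) τ +
      ((∫ z, llr ν (muP 2) z ∂ν + (1 - (mom 2 ν).toReal) / 2 : ℝ) : EReal) := by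
  have := isProbabilityMeasure_muP le_rfl
  have hsq := integrable_sq_of_mom hmom
  refine iSup_le fun t => ?_
  by_cases htop : Phi p t = ⊤
  · simp [htop]
  have ht := admissible_of_Phi_ne_top hp htop
  have hm : (mom 2 ν).toReal = ∫ z, z ^ 2 ∂ν := by
    rw [mom_two_eq hsq, ENNReal.toReal_ofReal (integral_nonneg fun z => sq_nonneg z)]
  have hm1 : (mom 2 ν).toReal ≤ 1 := ENNReal.toReal_le_of_le_ofReal one_pos.le (by simpa using hmom)
  have hell := ht.integrable_ell hp hsq
  have hDV := integral_sub_log_integral_exp_le hac hllr ((hsq.const_mul t.1).add hell)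
    (ht.integrable_exp_sq_add_ell hp)
  simp only [Pi.add_apply] at hDV
  rw [ht.integral_exp_sq_add_ell hp, integral_add (hsq.const_mul t.1) hell,
    integral_const_mul, ← hm] at hDV
  have hterm : ((t.2.1 * τ.1 + t.2.2 * τ.2 : ℝ) : EReal) - Psi p ν t.2 ≤
      legendre2 (Psi p ν) τ :=
    le_iSup (fun s : ℝ × ℝ => ((s.1 * τ.1 + s.2 * τ.2 : ℝ) : EReal) - Psi p ν s) t.2
  refine le_trans ?_ (add_le_add_left hterm _)
  rw [ht.phi_eq hp, show t.2 = (t.2.1, t.2.2) from rfl, ht.psi_eq hp hsq]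
  norm_cast
  have h1 := mul_nonneg (sub_nonneg.2 (ht.fst_le hp)) (sub_nonneg.2 hm1)
  simp only
  nlinarith

lemma Psi_zero {p : ℝ} (hp : 2 ≤ p) (ν : Measure ℝ) : Psi p ν (0, 0) = 0 := by
  have := isProbabilityMeasure_muP hp
  simp [Psi, LamP, eIntegral, erealToENNReal]

lemma Iq_nonneg {p : ℝ} (hp : 2 ≤ p) (ν : Measure ℝ) (w : ℝ) : 0 ≤ Iq p ν w := by
  refine le_iInf₂ fun τ _ => ?_
  refine le_trans ?_ (le_iSup (fun t : ℝ × ℝ =>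
    ((t.1 * τ.1 + t.2 * τ.2 : ℝ) : EReal) - Psi p ν t) (0, 0))
  simp [Psi_zero hp]

lemma Ia_le_Iq_add {p : ℝ} (hp : 2 ≤ p) {ν : Measure ℝ} [IsProbabilityMeasure ν]
    (hmom : mom 2 ν ≤ 1) (w : ℝ) :
    Ia p w ≤ Iq p ν w + relEnt ν (muP 2) + (((1 - (mom 2 ν).toReal) / 2 : ℝ) : EReal) := by
  have := isProbabilityMeasure_muP le_rfl
  rcases relEnt_eq_top_or (ν := ν) (μ := muP 2) with htop | ⟨hac, hllr⟩
  · rw [htop, EReal.add_top_of_ne_bot (ne_bot_of_le_ne_bot EReal.zero_ne_bot (Iq_nonneg hp ν w)),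
      EReal.top_add_coe]
    exact le_top
  · rw [relEnt_eq_coe hac hllr, add_assoc, ← EReal.coe_add,
      ← EReal.sub_le_iff_le_add (.inl (EReal.coe_ne_bot _)) (.inl (EReal.coe_ne_top _))]
    refine le_iInf₂ fun τ hτ => ?_
    rw [EReal.sub_le_iff_le_add (.inl (EReal.coe_ne_bot _)) (.inl (EReal.coe_ne_top _))]
    refine le_trans (iInf₂_le (1, τ) ⟨one_pos, hτ.1, ?_⟩)
      (legendre3_Phi_one_le hp hmom hac hllr τ)
    rw [Real.one_rpow, one_mul]
    exact hτ.2

lemma lintegral_comp_mul_left {s : ℝ} (hs : 0 < s) {f : ℝ → ℝ≥0∞} (hf : Measurable f) :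
    ∫⁻ z, f z = ENNReal.ofReal s * ∫⁻ z, f (s * z) := by
  rw [← lintegral_map hf (measurable_const_mul s), Real.map_volume_mul_left hs.ne',
    lintegral_smul_measure, smul_eq_mul, ← mul_assoc, ← ENNReal.ofReal_mul hs.le,
    abs_of_pos (by positivity),
    mul_inv_cancel₀ hs.ne', ENNReal.ofReal_one, one_mul]

lemma Phi_scale {p s : ℝ} (hs : 0 < s) (t : ℝ × ℝ × ℝ) :
    Phi p t = ((Real.log s : ℝ) : EReal) +
      Phi p (t.1 * s ^ 2 - s ^ 2 / 2 + 1 / 2, t.2.1 * s, t.2.2) := by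
  have hz : ∀ y, ∫⁻ z, ENNReal.ofReal (Real.exp
        (t.1 * z ^ 2 + t.2.1 * z * y + t.2.2 * |y| ^ p)) ∂(muP 2) =
      ENNReal.ofReal s * ∫⁻ z, ENNReal.ofReal (Real.exp
        ((t.1 * s ^ 2 - s ^ 2 / 2 + 1 / 2) * z ^ 2 + t.2.1 * s * z * y + t.2.2 * |y| ^ p))
          ∂(muP 2) := by
    intro y
    rw [lintegral_muP le_rfl _ (by fun_prop), lintegral_muP le_rfl _ (by fun_prop),
      lintegral_comp_mul_left hs (by fun_prop), mul_left_comm]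
    congr 2
    refine lintegral_congr fun z => ?_
    simp only [Real.rpow_two, sq_abs]
    ring_nf
  have := isProbabilityMeasure_muP le_rfl
  rw [Phi, Phi, ← ennreal_log_ofReal hs, ← ENNReal.log_mul_add]
  simp only [hz]
  rw [lintegral_const_mul]
  exact Measurable.lintegral_prod_right' (f := fun x : ℝ × ℝ => ENNReal.ofReal (Real.exp
        ((t.1 * s ^ 2 - s ^ 2 / 2 + 1 / 2) * x.2 ^ 2 + t.2.1 * s * x.2 * x.1 +
          t.2.2 * |x.1| ^ p))) (by fun_prop)

lemma legendre3_Phi_one_le_scale {p s : ℝ} (hs : 0 < s) (τ₁ τ₂ : ℝ) :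
    legendre3 (Phi p) (1, τ₁ / s, τ₂) ≤ legendre3 (Phi p) (s ^ 2, τ₁, τ₂) := by
  refine iSup_le fun t => ?_
  refine le_trans ?_ (le_iSup _ ((t.1 - 1 / 2) / s ^ 2 + 1 / 2, t.2.1 / s, t.2.2))
  have h1 : ((t.1 - 1 / 2) / s ^ 2 + 1 / 2) * s ^ 2 - s ^ 2 / 2 + 1 / 2 = t.1 := by
    field_simp; ring
  have h2 : t.2.1 / s * s = t.2.1 := by field_simp
  have hlog : Real.log s ≤ (s ^ 2 - 1) / 2 := by
    have := Real.log_le_sub_one_of_pos (pow_pos hs 2)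
    rw [Real.log_pow] at this
    push_cast at this
    linarith
  have h3 : ((t.1 - 1 / 2) / s ^ 2 + 1 / 2) * s ^ 2 + t.2.1 / s * τ₁ + t.2.2 * τ₂ =
      t.1 * 1 + t.2.1 * (τ₁ / s) + t.2.2 * τ₂ + (s ^ 2 - 1) / 2 := by
    field_simp; ring
  rw [Phi_scale hs ((t.1 - 1 / 2) / s ^ 2 + 1 / 2, _)]
  simp only [h1, h2, h3]
  induction Phi p (t.1, t.2.1, t.2.2) with
  | bot => simp only [EReal.add_bot, EReal.coe_sub_bot, le_refl]
  | top => simp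
  | coe x =>
    norm_cast
    linarith

/-- The linear functional `e ↦ expo p e x - ⟨e, τ⟩`. -/
def centeredExpo (p : ℝ) (τ : ℝ × ℝ × ℝ) (x : ℝ × ℝ) : (ℝ × ℝ × ℝ) →ₗ[ℝ] ℝ where
  toFun e := expo p e x - (e.1 * τ.1 + e.2.1 * τ.2.1 + e.2.2 * τ.2.2)
  map_add' e f := by simp only [expo, Prod.fst_add, Prod.snd_add]; ring
  map_smul' c e := by
    simp only [expo, Prod.smul_fst, Prod.smul_snd, smul_eq_mul, RingHom.id_apply]; ring

lemma centeredExpo_apply (p : ℝ) (τ e : ℝ × ℝ × ℝ) (x : ℝ × ℝ) : centeredExpo p τ x e =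
    expo p e x - (e.1 * τ.1 + e.2.1 * τ.2.1 + e.2.2 * τ.2.2) := rfl

lemma finite_quadratic_zeros {a b : ℝ} (c : ℝ) (h : a ≠ 0 ∨ b ≠ 0) :
    {z : ℝ | a * z ^ 2 + b * z + c = 0}.Finite := by
  set P : Polynomial ℝ := .C a * .X ^ 2 + .C b * .X + .C c with hP
  have hP0 : P ≠ 0 := by
    intro h0
    have h2 : P.coeff 2 = a := by simp [hP]
    have h1 : P.coeff 1 = b := by simp [hP, Polynomial.coeff_X_pow, Polynomial.coeff_C]
    rw [h0, Polynomial.coeff_zero] at h1 h2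
    rcases h with h | h
    · exact h h2.symm
    · exact h h1.symm
  refine (Polynomial.finite_setOfPred_isRoot hP0).subset fun z hz => ?_
  simpa [hP, Polynomial.IsRoot] using hz

lemma muP_finite (p : ℝ) {S : Set ℝ} (hS : S.Finite) : muP p S = 0 :=
  muP_absolutelyContinuous p (hS.measure_zero volume)

lemma finite_abs_rpow_eq {p : ℝ} (hp : 2 ≤ p) (c : ℝ) : {y : ℝ | |y| ^ p = c}.Finite := by
  refine (Set.toFinite {c ^ (1 / p), -c ^ (1 / p)}).subset fun y hy => ?_
  have hy : |y| ^ p = c := hy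
  have h : |y| = c ^ (1 / p) := by
    rw [← hy, ← Real.rpow_mul (abs_nonneg y), mul_one_div_cancel (by linarith), Real.rpow_one]
  rcases abs_choice y with h1 | h1
  · left; rw [← h, h1]
  · right; simp only [mem_singleton_iff]; rw [← h, h1, neg_neg]

lemma pairLaw_centeredExpo_eq_zero {p : ℝ} (hp : 2 ≤ p) (τ : ℝ × ℝ × ℝ) {e : ℝ × ℝ × ℝ}
    (he : e ≠ 0) : pairLaw p {x | centeredExpo p τ x e = 0} = 0 := by
  have := isProbabilityMeasure_muP le_rfl
  have hmeas : MeasurableSet {x | centeredExpo p τ x e = 0} := by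
    simp only [centeredExpo_apply]
    exact measurableSet_eq_fun (by fun_prop) measurable_const
  rw [pairLaw, Measure.measure_prod_null hmeas]
  have hy0 : ∀ᵐ y ∂(muP p), y ∉ ({0} : Set ℝ) :=
    measure_eq_zero_iff_ae_notMem.1 (muP_finite p (finite_singleton 0))
  have hy1 : ∀ᵐ y ∂(muP p), y ∉ {y : ℝ | |y| ^ p = τ.2.2} :=
    measure_eq_zero_iff_ae_notMem.1 (muP_finite p (finite_abs_rpow_eq hp _))
  filter_upwards [hy0, hy1] with y h0 h1
  simp only [mem_singleton_iff] at h0 h1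
  refine muP_finite 2 ?_
  have hset : Prod.mk y ⁻¹' {x | centeredExpo p τ x e = 0} = {z | e.1 * z ^ 2 + e.2.1 * y * z +
      (e.2.2 * |y| ^ p - (e.1 * τ.1 + e.2.1 * τ.2.1 + e.2.2 * τ.2.2)) = 0} := by
    ext z
    simp only [mem_preimage, mem_ofPred_eq, centeredExpo_apply, expo]
    ring_nf
  rw [hset]
  by_cases h : e.1 ≠ 0 ∨ e.2.1 * y ≠ 0
  · exact finite_quadratic_zeros _ h
  push Not at h
  have h2 : e.2.1 = 0 := (mul_eq_zero.1 h.2).resolve_right h0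
  have h3 : e.2.2 ≠ 0 := fun h3 => he (Prod.ext h.1 (Prod.ext h2 h3))
  convert Set.finite_empty
  ext z
  simp only [h.1, h2, mem_ofPred_eq, mem_empty_iff_false, iff_false]
  intro h4
  refine h1 ?_
  have : e.2.2 * (|y| ^ p - τ.2.2) = 0 := by linarith
  linarith [(mul_eq_zero.1 this).resolve_left h3]

lemma lintegral_exp_centeredExpo (p : ℝ) (τ t : ℝ × ℝ × ℝ) :
    ∫⁻ x, ENNReal.ofReal (Real.exp (centeredExpo p τ x t)) ∂(pairLaw p) =
      ENNReal.ofReal (Real.exp (-(t.1 * τ.1 + t.2.1 * τ.2.1 + t.2.2 * τ.2.2))) *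
        ∫⁻ x, ENNReal.ofReal (Real.exp (expo p t x)) ∂(pairLaw p) := by
  rw [← lintegral_const_mul _ (by fun_prop)]
  refine lintegral_congr fun x => ?_
  rw [centeredExpo_apply, ← ENNReal.ofReal_mul (Real.exp_pos _).le, ← Real.exp_add]
  ring_nf

lemma exp_neg_le_lintegral_centeredExpo {p : ℝ} (hp : 2 ≤ p) {τ : ℝ × ℝ × ℝ} {l : ℝ}
    (hl : legendre3 (Phi p) τ ≤ (l : EReal)) (t : ℝ × ℝ × ℝ) :
    ENNReal.ofReal (Real.exp (-l)) ≤
      ∫⁻ x, ENNReal.ofReal (Real.exp (centeredExpo p τ x t)) ∂(pairLaw p) := by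
  have := isProbabilityMeasure_pairLaw hp
  have hG := lintegral_exp_centeredExpo p τ t
  by_cases htop : Phi p t = ⊤
  · rw [Phi_eq, ENNReal.log_eq_top_iff] at htop
    rw [hG, htop, ENNReal.mul_top (by simpa using Real.exp_pos _)]
    exact le_top
  have ht := admissible_of_Phi_ne_top hp htop
  have hint := ht.integrable hp
  have h1 := (le_iSup (fun t : ℝ × ℝ × ℝ =>
    ((t.1 * τ.1 + t.2.1 * τ.2.1 + t.2.2 * τ.2.2 : ℝ) : EReal) - Phi p t) t).trans hl
  simp only [ht.phi_eq hp] at h1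
  norm_cast at h1
  rw [hG, ← ofReal_integral_eq_lintegral_ofReal hint (ae_of_all _ fun _ => (Real.exp_pos _).le),
    ← ENNReal.ofReal_mul (Real.exp_pos _).le, ← Real.exp_log (integral_exp_pos hint),
    ← Real.exp_add]
  refine ENNReal.ofReal_le_ofReal (Real.exp_le_exp.2 ?_)
  linarith

lemma tilted_sub_const {Ω : Type*} [MeasurableSpace Ω] {μ : Measure Ω} [IsProbabilityMeasure μ]
    {f : Ω → ℝ} (hf : Integrable (fun x => Real.exp (f x)) μ) (c : ℝ) :
    μ.tilted (fun x => f x - c) = μ.tilted f := by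
  have := isProbabilityMeasure_tilted hf
  rw [← tilted_const (μ.tilted f) (-c), tilted_tilted hf]
  rfl

/-- If the Legendre transform of `Phi p` is finite at `τ`, then some exponential tilt of the pair
law has moments `τ`. -/
lemma exists_admissible_integral_tilted_eq {p : ℝ} (hp : 2 ≤ p) {τ : ℝ × ℝ × ℝ}
    (hτ : legendre3 (Phi p) τ ≠ ⊤) :
    ∃ t, Admissible p t ∧ ∀ e, Integrable (expo p e) ((pairLaw p).tilted (expo p t)) ∧
      ∫ x, expo p e x ∂(pairLaw p).tilted (expo p t) =
        e.1 * τ.1 + e.2.1 * τ.2.1 + e.2.2 * τ.2.2 := by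
  have := isProbabilityMeasure_pairLaw hp
  have hψ : ∀ t, Measurable fun x => centeredExpo p τ x t := fun t => by
    simp only [centeredExpo_apply]; fun_prop
  obtain ⟨t, hmin⟩ := exists_minimizer_lintegral_exp hψ
    (fun e he => pairLaw_centeredExpo_eq_zero hp τ he)
    (by simpa using Real.exp_pos _)
    (exp_neg_le_lintegral_centeredExpo hp (EReal.le_coe_toReal hτ))
  have ht : Admissible p t := by
    refine admissible_of_Phi_ne_top hp fun htop => ?_
    have h0 := hmin 0
    rw [Phi_eq, ENNReal.log_eq_top_iff] at htop
    rw [lintegral_exp_centeredExpo p τ t, htop,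
      ENNReal.mul_top (by simpa using Real.exp_pos _)] at h0
    simp at h0
  refine ⟨t, ht, fun e => ?_⟩
  have hprob := isProbabilityMeasure_tilted (ht.integrable hp)
  have hfoc := integral_tilted_eq_zero_of_minimizer (μ := pairLaw p) (fun e => ?_) hmin e
  · simp only [centeredExpo_apply, tilted_sub_const (ht.integrable hp)] at hfoc
    have hint : Integrable (expo p e) ((pairLaw p).tilted (expo p t)) := by
      refine (hfoc.1.add (integrable_const
        (e.1 * τ.1 + e.2.1 * τ.2.1 + e.2.2 * τ.2.2))).congr (ae_of_all _ fun x => ?_)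
      simp
    refine ⟨hint, ?_⟩
    rw [integral_sub hint (integrable_const _)] at hfoc
    simpa [sub_eq_zero] using hfoc.2
  · obtain ⟨ε, hε, h⟩ := ht.perturb hp e
    refine ⟨ε, hε, fun h' hh' => ?_⟩
    have hi := ((h h' hh').integrable hp).mul_const
      (Real.exp (-((t + h' • e).1 * τ.1 + (t + h' • e).2.1 * τ.2.1 + (t + h' • e).2.2 * τ.2.2)))
    refine hi.congr (ae_of_all _ fun x => ?_)
    simp only
    rw [← Real.exp_add, centeredExpo_apply, sub_eq_add_neg]
    rfl

section Tilt

variable {p : ℝ} {t : ℝ × ℝ × ℝ}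

/-- The `z`-marginal of the pair law tilted by `expo p t`. -/
def tiltMarginal (p : ℝ) (t : ℝ × ℝ × ℝ) : Measure ℝ :=
  (muP 2).tilted fun z => t.1 * z ^ 2 + ell p t z

/-- The conditional law of `y` given `z` under the pair law tilted by `expo p t`. -/
def tiltCond (p : ℝ) (t : ℝ × ℝ × ℝ) (z : ℝ) : Measure ℝ :=
  (muP p).tilted fun y => t.2.1 * z * y + t.2.2 * |y| ^ p

lemma Admissible.isProbabilityMeasure_tiltMarginal (hp : 2 ≤ p) (ht : Admissible p t) :
    IsProbabilityMeasure (tiltMarginal p t) := by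
  have := isProbabilityMeasure_muP le_rfl
  exact isProbabilityMeasure_tilted (ht.integrable_exp_sq_add_ell hp)

lemma Admissible.isProbabilityMeasure_tiltCond (hp : 2 ≤ p) (ht : Admissible p t) (z : ℝ) :
    IsProbabilityMeasure (tiltCond p t z) := by
  have := isProbabilityMeasure_muP hp
  exact isProbabilityMeasure_tilted (ht.integrable_slice hp z)

/-- Disintegration of the tilted pair law along its second coordinate. -/
lemma Admissible.disintegrate (hp : 2 ≤ p) (ht : Admissible p t) {F : ℝ × ℝ → ℝ}
    (hF : Integrable F ((pairLaw p).tilted (expo p t))) :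
    (∀ᵐ z ∂(tiltMarginal p t), Integrable (fun y => F (y, z)) (tiltCond p t z)) ∧
      Integrable (fun z => ∫ y, F (y, z) ∂(tiltCond p t z)) (tiltMarginal p t) ∧
      ∫ z, (∫ y, F (y, z) ∂(tiltCond p t z)) ∂(tiltMarginal p t) =
        ∫ x, F x ∂(pairLaw p).tilted (expo p t) := by
  have := isProbabilityMeasure_muP hp
  have := isProbabilityMeasure_muP le_rfl
  have hslice := ht.integrable_slice hp
  have hF' : Integrable (fun x => Real.exp (expo p t x) * F x) (pairLaw p) :=
    (integrable_tilted_iff (ht.integrable hp) F).1 hF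
  have hsec : ∀ z, ∫ y, Real.exp (expo p t (y, z)) * F (y, z) ∂(muP p) =
      Real.exp (t.1 * z ^ 2 + ell p t z) * ∫ y, F (y, z) ∂(tiltCond p t z) := by
    intro z
    rw [tiltCond, integral_tilted, Real.exp_add, ht.exp_ell hp, ← integral_const_mul]
    have hpos := (integral_exp_pos (hslice z)).ne'
    refine integral_congr_ae (ae_of_all _ fun y => ?_)
    simp only [exp_expo, smul_eq_mul]
    generalize ∫ y, Real.exp (t.2.1 * z * y + t.2.2 * |y| ^ p) ∂(muP p) = I at hpos ⊢
    field_simp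
  refine ⟨?_, ?_, ?_⟩
  · refine (tilted_absolutelyContinuous _ _).ae_le ?_
    filter_upwards [hF'.prod_left_ae] with z hz
    rw [tiltCond, integrable_tilted_iff (hslice z)]
    refine (hz.const_mul (Real.exp (t.1 * z ^ 2))⁻¹).congr (ae_of_all _ fun y => ?_)
    simp only [exp_expo, smul_eq_mul]
    have := Real.exp_pos (t.1 * z ^ 2)
    field_simp
  · rw [tiltMarginal, integrable_tilted_iff (ht.integrable_exp_sq_add_ell hp)]
    refine hF'.integral_prod_right.congr (ae_of_all _ fun z => ?_)
    exact hsec z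
  · rw [tiltMarginal, integral_tilted, integral_tilted, ht.integral_exp_sq_add_ell hp]
    simp only [smul_eq_mul, div_eq_inv_mul, mul_assoc]
    rw [integral_const_mul, integral_const_mul]
    congr 1
    refine Eq.trans ?_ (integral_prod_symm _ hF').symm
    exact integral_congr_ae (ae_of_all _ fun z => (hsec z).symm)

lemma log_integral_exp_add_integral_tilted_le {μ : Measure ℝ} [IsProbabilityMeasure μ]
    {f X : ℝ → ℝ} (hfm : Measurable f) (hXm : Measurable X)
    (hf : Integrable (fun x => Real.exp (f x)) μ) (hX : Integrable X (μ.tilted f)) :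
    ((Real.log (∫ x, Real.exp (f x) ∂μ) + ∫ x, X x ∂(μ.tilted f) : ℝ) : EReal) ≤
      ENNReal.log (∫⁻ x, ENNReal.ofReal (Real.exp (f x + X x)) ∂μ) := by
  have := isProbabilityMeasure_tilted hf
  by_cases h : Integrable (fun x => Real.exp (f x + X x)) μ
  · have hX' : Integrable (fun x => Real.exp (X x)) (μ.tilted f) := by
      rw [integrable_tilted_iff hf]
      simpa only [smul_eq_mul, ← Real.exp_add] using h
    have hJ := integral_le_log_integral_exp hX hX'
    have h1 := integral_exp_pos hf
    have h2 : 0 < ∫ x, Real.exp (f x + X x) ∂μ := integral_exp_pos h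
    rw [integral_exp_tilted] at hJ
    simp only [Pi.add_apply] at hJ
    rw [Real.log_div h2.ne' h1.ne'] at hJ
    rw [← ofReal_integral_eq_lintegral_ofReal h (ae_of_all _ fun _ => (Real.exp_pos _).le),
      ennreal_log_ofReal h2]
    norm_cast
    linarith
  · have htop : ∫⁻ x, ENNReal.ofReal (Real.exp (f x + X x)) ∂μ = ⊤ := by
      by_contra hne
      refine h ⟨by fun_prop, ?_⟩
      rw [hasFiniteIntegral_iff_ofReal (ae_of_all _ fun _ => (Real.exp_pos _).le)]
      exact Ne.lt_top hne
    simp [htop]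

lemma Admissible.integral_sq_tiltMarginal (hp : 2 ≤ p) (ht : Admissible p t)
    (h : Integrable (expo p (1, 0, 0)) ((pairLaw p).tilted (expo p t))) :
    Integrable (fun z : ℝ => z ^ 2) (tiltMarginal p t) ∧
      ∫ z, z ^ 2 ∂(tiltMarginal p t) =
        ∫ x, expo p (1, 0, 0) x ∂(pairLaw p).tilted (expo p t) := by
  obtain ⟨-, h1, h2⟩ := ht.disintegrate hp h
  have hc := ht.isProbabilityMeasure_tiltCond hp
  simp only [expo, one_mul, zero_mul, add_zero, integral_const, probReal_univ, one_smul] at h1 h2 ⊢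
  exact ⟨h1, h2⟩

lemma Admissible.le_psi_tiltMarginal (hp : 2 ≤ p) (ht : Admissible p t)
    (hsq : Integrable (fun z : ℝ => z ^ 2) (tiltMarginal p t)) (s : ℝ × ℝ)
    (hF : Integrable (expo p (0, s.1 - t.2.1, s.2 - t.2.2)) ((pairLaw p).tilted (expo p t))) :
    ((∫ z, ell p t z ∂(tiltMarginal p t) +
      ∫ x, expo p (0, s.1 - t.2.1, s.2 - t.2.2) x ∂(pairLaw p).tilted (expo p t) : ℝ) : EReal) ≤
      Psi p (tiltMarginal p t) s := by
  have := isProbabilityMeasure_muP hp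
  have := ht.isProbabilityMeasure_tiltMarginal hp
  obtain ⟨h0, h1, h2⟩ := ht.disintegrate hp hF
  have hell := ht.integrable_ell hp hsq
  rw [← h2, ← integral_add hell h1, Psi]
  refine (eIntegral_coe (hell.add h1)).symm.trans_le ?_
  refine eIntegral_mono_ae ?_
  filter_upwards [h0] with z hz
  refine (log_integral_exp_add_integral_tilted_le (by fun_prop) (by fun_prop)
    (ht.integrable_slice hp z) hz).trans_eq ?_
  rw [LamP]
  congr 2 with y
  simp only [expo]
  ring_nf

lemma Admissible.relEnt_tiltMarginal (hp : 2 ≤ p) (ht : Admissible p t)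
    (hsq : Integrable (fun z : ℝ => z ^ 2) (tiltMarginal p t)) :
    relEnt (tiltMarginal p t) (muP 2) = ((t.1 * ∫ z, z ^ 2 ∂(tiltMarginal p t) +
      ∫ z, ell p t z ∂(tiltMarginal p t) -
        Real.log (∫ x, Real.exp (expo p t x) ∂(pairLaw p)) : ℝ) : EReal) := by
  have := isProbabilityMeasure_muP le_rfl
  have := ht.isProbabilityMeasure_tiltMarginal hp
  have hell := ht.integrable_ell hp hsq
  have hac : tiltMarginal p t ≪ muP 2 := tilted_absolutelyContinuous _ _
  have hllr : llr (tiltMarginal p t) (muP 2) =ᵐ[tiltMarginal p t] fun z =>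
      t.1 * z ^ 2 + ell p t z - Real.log (∫ x, Real.exp (expo p t x) ∂(pairLaw p)) := by
    have h := log_rnDeriv_tilted_left_self (ht.integrable_exp_sq_add_ell hp)
    rw [ht.integral_exp_sq_add_ell hp] at h
    exact hac.ae_le h
  have hint : Integrable (fun z => t.1 * z ^ 2 + ell p t z) (tiltMarginal p t) :=
    (hsq.const_mul t.1).add hell
  rw [relEnt_eq_coe hac ((integrable_congr hllr).2 (hint.sub (integrable_const _))),
    integral_congr_ae hllr, integral_sub hint (integrable_const _),
    integral_add (hsq.const_mul t.1) hell, integral_const_mul]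
  simp

lemma exists_Iq_add_relEnt_le (hp : 2 ≤ p) {τ : ℝ × ℝ} (hτ : 0 < τ.2)
    (hfin : legendre3 (Phi p) (1, τ) ≠ ⊤) :
    ∃ ν : Measure ℝ, IsProbabilityMeasure ν ∧ mom 2 ν = 1 ∧
      Iq p ν (τ.1 * τ.2 ^ (-(1 : ℝ) / p)) + relEnt ν (muP 2) ≤ legendre3 (Phi p) (1, τ) := by
  obtain ⟨t, ht, hmom⟩ := exists_admissible_integral_tilted_eq hp hfin
  obtain ⟨hsq, hsq1⟩ := ht.integral_sq_tiltMarginal hp (hmom (1, 0, 0)).1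
  rw [(hmom (1, 0, 0)).2] at hsq1
  simp only [mul_one, zero_mul, add_zero] at hsq1
  refine ⟨tiltMarginal p t, ht.isProbabilityMeasure_tiltMarginal hp, ?_, ?_⟩
  · rw [mom_two_eq hsq, hsq1, ENNReal.ofReal_one]
  have hleg : legendre2 (Psi p (tiltMarginal p t)) τ ≤
      ((t.2.1 * τ.1 + t.2.2 * τ.2 - ∫ z, ell p t z ∂(tiltMarginal p t) : ℝ) : EReal) := by
    refine iSup_le fun s => ?_
    obtain ⟨h1, h2⟩ := hmom (0, s.1 - t.2.1, s.2 - t.2.2)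
    refine (EReal.sub_le_sub le_rfl (ht.le_psi_tiltMarginal hp hsq s h1)).trans ?_
    rw [h2]
    norm_cast
    linarith
  have hIq : Iq p (tiltMarginal p t) (τ.1 * τ.2 ^ (-(1 : ℝ) / p)) ≤ _ :=
    (iInf₂_le τ ⟨hτ, rfl⟩).trans hleg
  refine (add_le_add_left hIq _).trans ?_
  refine le_trans ?_ (le_iSup _ t)
  rw [ht.relEnt_tiltMarginal hp hsq, ht.phi_eq hp, hsq1]
  norm_cast
  linarith

end Tilt

end LDP

open LDP

/-- Variational formula relating the annealed and quenched rate functions. -/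
theorem statement4 (p : ℝ) (hp : 2 ≤ p) :
    (∀ w : ℝ, Ia p w =
      ⨅ ν ∈ {ν : Measure ℝ | IsProbabilityMeasure ν ∧ mom 2 ν ≤ 1},
        Iq p ν w + relEnt ν (muP 2) + (((1 - (mom 2 ν).toReal) / 2 : ℝ) : EReal))
    ∧ (∀ w : ℝ, Ia p w ≤ Iq p (muP 2) w) := by
  have := isProbabilityMeasure_muP le_rfl
  have hmom := mom_two_muP_two
  refine ⟨fun w => le_antisymm (le_iInf₂ fun ν hν => ?_) (le_iInf₂ fun τ hτ => ?_), fun w => ?_⟩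
  · have := hν.1
    exact Ia_le_Iq_add hp hν.2 w
  · obtain ⟨τ₀, τ₁, τ₂⟩ := τ
    obtain ⟨h0, h2, hw⟩ := hτ
    simp only at h0 h2 hw
    have hs : 0 < Real.sqrt τ₀ := Real.sqrt_pos.2 h0
    have hscale := legendre3_Phi_one_le_scale (p := p) hs τ₁ τ₂
    rw [Real.sq_sqrt h0.le] at hscale
    refine le_trans ?_ hscale
    by_cases htop : legendre3 (Phi p) (1, τ₁ / Real.sqrt τ₀, τ₂) = ⊤
    · rw [htop]; exact le_top
    obtain ⟨ν, hν, hm, hle⟩ := exists_Iq_add_relEnt_le hp (τ := (τ₁ / Real.sqrt τ₀, τ₂)) h2 htop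
    have hw' : τ₁ / Real.sqrt τ₀ * τ₂ ^ (-(1 : ℝ) / p) = w := by
      rw [← hw, neg_div 2 (1 : ℝ), Real.rpow_neg h0.le, ← Real.sqrt_eq_rpow]
      ring
    simp only [hw'] at hle
    refine (iInf₂_le ν ⟨hν, hm.le⟩).trans ?_
    simpa [hm] using hle
  · simpa [relEnt_self, hmom] using Ia_le_Iq_add hp hmom.le w
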